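/- The truncated Demazure–Lusztig operators T_1,…,T_r satisfy the type C_r braid relations — T_i T_{i+1} T_i = T_{i+1} T_i T_{i+1} for 1 ≤ i ≤ r−2, T_{r−1} T_r T_{r−1} T_r = T_r T_{r−1} T_r T_{r−1}, and T_i T_{i'} = T_{i'} T_i whenever |i − i'| > 1 — as well as the quadratic Hecke relations (T_i − k)∘(T_i + k^{−1}) = 0 for 1 ≤ i < r and (T_r − k_r)∘(T_r + k_r^{−1}) = 0, as identities of F-linear operators on F[ℝ^r]. -/

import Mathlib

open scoped Classical

noncomputable section

namespace QP

/-! ### The space of quasi-polynomials -/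

/-- Euclidean space `ℝ^r`. -/
abbrev E (r : ℕ) := Fin r → ℝ

variable (F : Type*) [Field F] [CharZero F] (r : ℕ)

/-- The algebra of quasi-polynomials `F[ℝ^r]`: the group algebra of `(ℝ^r,+)` over `F`. -/
abbrev QA := AddMonoidAlgebra F (E r)

/-- The quasi-monomial `x^y`. -/
def X (y : E r) : QA F r := AddMonoidAlgebra.single y 1

/-- The `i`-th coordinate of a vector (`1`-based). -/
def cd (y : E r) (i : ℕ) : ℝ := ∑ m : Fin r, if (m : ℕ) + 1 = i then y m else 0

/-- The standard basis vector `ε_i` (`1`-based). -/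
def epsV (i : ℕ) : E r := fun m => if (m : ℕ) + 1 = i then 1 else 0

/-- The standard basis vector (`0`-based). -/
def eV (m : Fin r) : E r := fun n => if n = m then 1 else 0

/-- The Euclidean inner product on `ℝ^r`. -/
def ip (v y : E r) : ℝ := ∑ m : Fin r, v m * y m

/-- An integral vector regarded as an element of `ℝ^r`. -/
def zc (lam : Fin r → ℤ) : E r := fun m => (lam m : ℝ)

/-- The simple reflections of the hyperoctahedral group `W₀ = S_r ⋉ (±1)^r` (`1`-based):
for `1 ≤ i < r`, `sW i` interchanges the `i`-th and `(i+1)`-st coordinates, and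
`sW r` negates the last coordinate. -/
def sW (i : ℕ) (y : E r) : E r := fun m =>
  if i = r then (if (m : ℕ) + 1 = r then -y m else y m)
  else if (m : ℕ) + 1 = i then cd r y (i + 1)
  else if (m : ℕ) = i then cd r y i
  else y m

/-- `s_{ε₁} = s₁⋯s_{r-1} s_r s_{r-1}⋯s₁`: negation of the first coordinate. -/
def sEps1 (y : E r) : E r := fun m => if (m : ℕ) = 0 then -y m else y m

/-- The affine simple reflection `s₀ = τ(ε₁) s_{ε₁} : y ↦ (1 - y₁, y₂, …, y_r)`, together
with `genF j = sW j` for `1 ≤ j ≤ r`: the Coxeter generators of the affine Weyl group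
`W = W₀ ⋉ ℤ^r`. -/
def genF (j : ℕ) (y : E r) : E r :=
  if j = 0 then fun m => if (m : ℕ) = 0 then 1 - y m else y m
  else sW r j y

/-- The action of the word `s_{j₁} ⋯ s_{j_ℓ}` on `ℝ^r`. -/
def wordAct (l : List ℕ) (y : E r) : E r := l.foldr (genF r) y

/-- The closure of the fundamental alcove
`C₊ = {y : 0 < y_r < ⋯ < y₁ < 1/2}`. -/
def CplusCl : Set (E r) :=
  {y | (∀ i j : Fin r, i ≤ j → y j ≤ y i) ∧ ∀ m : Fin r, 0 ≤ y m ∧ y m ≤ 1 / 2}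

/-- The `W`-orbit of a point of `ℝ^r`. -/
def orbit (y : E r) : Set (E r) :=
  {z | ∃ l : List ℕ, (∀ a ∈ l, a ≤ r) ∧ wordAct r l y = z}

/-- `O` is a `W`-orbit in `ℝ^r`. -/
def IsOrbit (O : Set (E r)) : Prop := ∃ y, O = orbit r y

/-- `c^𝒪`: the unique point of the orbit `O` lying in the closed fundamental alcove. -/
def cpt (O : Set (E r)) : E r :=
  if h : ∃ c, c ∈ O ∧ c ∈ CplusCl r then h.choose else 0

/-- The length of an element of the affine Weyl group `W` (as a map on `ℝ^r`). -/
def wlen (g : E r → E r) : ℕ :=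
  sInf {n | ∃ l : List ℕ, (∀ a ∈ l, a ≤ r) ∧ l.length = n ∧ (fun y => wordAct r l y) = g}

/-- A choice of a shortest word `l` whose inverse maps `y` into the closed alcove;
the corresponding element of `W` is `g_y`. -/
def gW (y : E r) : List ℕ :=
  if h : ∃ l : List ℕ, (∀ a ∈ l, a ≤ r) ∧ wordAct r l.reverse y ∈ CplusCl r ∧
      ∀ l' : List ℕ, (∀ a ∈ l', a ≤ r) → wordAct r l'.reverse y ∈ CplusCl r →
        l.length ≤ l'.length
  then h.choose else []

/-- `g_y`, the unique shortest element of `W` with `g_y⁻¹ y` in the closed alcove. -/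
def gfun (y : E r) : E r → E r := fun z => wordAct r (gW r y) z

/-- The Bruhat order on `(W, {s₀,…,s_r})`, via the subword characterisation. -/
def bruhatLE (u v : E r → E r) : Prop :=
  ∃ l : List ℕ, (∀ a ∈ l, a ≤ r) ∧ (fun z => wordAct r l z) = v ∧ l.length = wlen r v ∧
    ∃ l' : List ℕ, l'.Sublist l ∧ (fun z => wordAct r l' z) = u ∧ l'.length = wlen r u

/-- The partial order on `ℝ^r`: `y' ≤ y` iff `y'` and `y` lie in the same `W`-orbit and
`g_{y'} ≤_B g_y` in the Bruhat order. -/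
def qle (y' y : E r) : Prop :=
  (∃ l : List ℕ, (∀ a ∈ l, a ≤ r) ∧ wordAct r l y = y') ∧ bruhatLE r (gfun r y') (gfun r y)

/-- Strict version of `qle`. -/
def qlt (y' y : E r) : Prop := qle r y' y ∧ y' ≠ y

/-- The `F`-linear operator on `F[ℝ^r]` determined by its values on the quasi-monomials. -/
def mkOp (Ψ : E r → QA F r) : Module.End F (QA F r) :=
  Finsupp.linearCombination F Ψ ∘ₗ (AddMonoidAlgebra.coeffLinearEquiv F).toLinearMap

/-- `F[O] = span_F {x^y : y ∈ O}`. -/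
def FO (O : Set (E r)) : Submodule F (QA F r) :=
  Submodule.span F {p | ∃ y ∈ O, p = X F r y}

/-- The Laurent polynomial subalgebra `F[ℤ^r] = span_F {x^μ : μ ∈ ℤ^r}`. -/
def Lspan : Submodule F (QA F r) :=
  Submodule.span F {p | ∃ lam : Fin r → ℤ, p = X F r (zc r lam)}

/-- `span_F {x^{y'} : y' < y}`. -/
def ltSpan (y : E r) : Submodule F (QA F r) :=
  Submodule.span F {p | ∃ y', qlt r y' y ∧ p = X F r y'}

/-! ### Floors and indicator/sign functions -/

/-- the largest even integer `≤ z` -/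
def floorE (z : ℝ) : ℤ := 2 * ⌊z / 2⌋
/-- the largest odd integer `≤ z` -/
def floorO (z : ℝ) : ℤ := 2 * ⌊(z + 1) / 2⌋ - 1
/-- indicator of `ℤ ⊆ ℝ` -/
def chiZ (z : ℝ) : ℕ := if ∃ n : ℤ, z = n then 1 else 0
/-- indicator of the even integers -/
def chiE (z : ℝ) : ℕ := if ∃ n : ℤ, z = 2 * n then 1 else 0
/-- indicator of the odd integers -/
def chiO (z : ℝ) : ℕ := if ∃ n : ℤ, z = 2 * n + 1 then 1 else 0
/-- `η_e`: `1` on even integers `≥ 2`, `-1` on even integers `≤ 0`, `0` otherwise -/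
def etaE (z : ℝ) : ℤ := if ∃ n : ℤ, z = 2 * n then (if 2 ≤ z then 1 else -1) else 0
/-- `η_o`: `1` on odd integers `≥ 1`, `-1` on odd integers `≤ -1`, `0` otherwise -/
def etaO (z : ℝ) : ℤ := if ∃ n : ℤ, z = 2 * n + 1 then (if 1 ≤ z then 1 else -1) else 0
/-- `η = η_e + η_o` -/
def eta (z : ℝ) : ℤ := etaE z + etaO z

/-- `geomS c v m` is the truncated geometric series `(1 - (c·x^v)^m)/(1 - c·x^v)`,
a genuine element of `F[ℝ^r]`; it is the unique element with
`(1 - c·x^v) * geomS c v m = 1 - c^m·x^{m v}`. -/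
def geomS (c : F) (v : E r) (m : ℤ) : QA F r :=
  if 0 ≤ m then ∑ t ∈ Finset.range m.toNat, c ^ (t : ℤ) • X F r ((t : ℝ) • v)
  else -∑ t ∈ Finset.range (-m).toNat, c ^ (-(t : ℤ) - 1) • X F r ((-(t : ℝ) - 1) • v)

/-! ### Truncated divided difference operators and Demazure–Lusztig operators -/

/-- `∇_i(x^y) = ((1 - (x_{i+1}/x_i)^{⌊y_i - y_{i+1}⌋})/(1 - x_i/x_{i+1}))·x^y`. -/
def nablaIel (i : ℕ) (y : E r) : QA F r :=
  geomS F r 1 (epsV r i - epsV r (i + 1)) (-⌊cd r y i - cd r y (i + 1)⌋) * X F r y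

/-- `∇_r^e(x^y) = ((1 - x_r^{-⌊2y_r⌋_e})/(1 - x_r^2))·x^y`. -/
def nablaReEl (y : E r) : QA F r :=
  geomS F r 1 ((2 : ℝ) • epsV r r) (-floorE (2 * cd r y r) / 2) * X F r y

/-- `∇_r^o(x^y) = ((x_r - x_r^{-⌊2y_r⌋_o})/(1 - x_r^2))·x^y`. -/
def nablaRoEl (y : E r) : QA F r :=
  X F r (epsV r r) *
    geomS F r 1 ((2 : ℝ) • epsV r r) ((-floorO (2 * cd r y r) - 1) / 2) * X F r y

def nablaIop (i : ℕ) : Module.End F (QA F r) := mkOp F r (nablaIel F r i)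
def nablaReOp : Module.End F (QA F r) := mkOp F r (nablaReEl F r)
def nablaRoOp : Module.End F (QA F r) := mkOp F r (nablaRoEl F r)

/-- The value of the truncated Demazure–Lusztig operator `T_i` (`1 ≤ i ≤ r`) on `x^y`. -/
def Tel (k kr ur : F) (i : ℕ) (y : E r) : QA F r :=
  if i = r then
    (kr ^ chiE (2 * cd r y r) * ur ^ chiO (2 * cd r y r)) • X F r (sW r r y)
      + (kr - kr⁻¹) • nablaReEl F r y + (ur - ur⁻¹) • nablaRoEl F r y
  else
    k ^ chiZ (cd r y i - cd r y (i + 1)) • X F r (sW r i y)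
      + (k - k⁻¹) • nablaIel F r i y

/-- The truncated Demazure–Lusztig operators `T_1, …, T_r` on `F[ℝ^r]`. -/
def Top (k kr ur : F) (i : ℕ) : Module.End F (QA F r) := mkOp F r (Tel F r k kr ur i)

/-! ### The torus and the affine generator -/

/-- `t^{ε_i}`: the `i`-th coordinate (`1`-based) of an element of the torus `T = (Fˣ)^r`. -/
def tcU (t : Fin r → Fˣ) (i : ℕ) : Fˣ := ∏ m : Fin r, if (m : ℕ) + 1 = i then t m else 1

/-- `t^λ` for `λ ∈ ℤ^r`. -/
def upow (t : Fin r → Fˣ) (lam : Fin r → ℤ) : Fˣ := ∏ m : Fin r, t m ^ lam m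

/-- `t^v` for a vector `v` with integral entries (entries read off via the floor). -/
def upowR (t : Fin r → Fˣ) (v : E r) : Fˣ := ∏ m : Fin r, t m ^ ⌊v m⌋

/-- The `W`-action on the torus `T = (Fˣ)^r`: for `g = τ(λ)w₀ ∈ W` (so `g y = w₀ y + λ`),
`(g t)_m = q^{λ_m} · t^{w₀⁻¹ ε_m}`, where `W₀` permutes and inverts coordinates and
`τ(λ) t = q^λ t`, with `q = (q^{1/2})²`. -/
def torusAct (qh : Fˣ) (g : E r → E r) (t : Fin r → Fˣ) : Fin r → Fˣ := fun m =>
  (qh * qh) ^ ⌊g 0 m⌋ * ∏ j : Fin r, t j ^ ⌊(g (eV r j) - g 0) m⌋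

/-- The action on the torus of the linear part of `g` alone (the `W₀`-action). -/
def torusAct0 (g : E r → E r) (t : Fin r → Fˣ) : Fin r → Fˣ := fun m =>
  ∏ j : Fin r, t j ^ ⌊(g (eV r j) - g 0) m⌋

/-- The simple affine roots `α₀(y) = 1 - 2y₁`, `α_i(y) = y_i - y_{i+1}` (`1 ≤ i < r`),
`α_r(y) = 2 y_r` as affine-linear functionals. -/
def alphaF (j : ℕ) (y : E r) : ℝ :=
  if j = 0 then 1 - 2 * cd r y 1
  else if j = r then 2 * cd r y r
  else cd r y j - cd r y (j + 1)

/-- `t^{α_j^∨}` where `α₀^∨ = (-ε₁, 1/2)`, `α_i^∨ = (ε_i - ε_{i+1}, 0)`, `α_r^∨ = (ε_r, 0)`. -/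
def tpowCo (qh : Fˣ) (t : Fin r → Fˣ) (j : ℕ) : Fˣ :=
  if j = 0 then qh * (tcU F r t 1)⁻¹
  else if j = r then tcU F r t r
  else tcU F r t j * (tcU F r t (j + 1))⁻¹

/-- The affine subtorus `T_𝒪 = {t ∈ T : t^{α_j^∨} = 1 whenever α_j(c^𝒪) = 0}`. -/
def TOset (qh : Fˣ) (O : Set (E r)) : Set (Fin r → Fˣ) :=
  {t | ∀ j : ℕ, j ≤ r → alphaF r j (cpt r O) = 0 → tpowCo F r qh t j = 1}

/-- `∇₀^e(x^y) = ((1 - (q^{-1/2}x₁)^{⌊-2y₁⌋_e})/(1 - q x₁^{-2}))·x^y`. -/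
def nabla0eEl (qh : F) (y : E r) : QA F r :=
  geomS F r (qh * qh) ((-2 : ℝ) • epsV r 1) (-floorE (-2 * cd r y 1) / 2) * X F r y

/-- `∇₀^o(x^y) = ((q^{1/2}x₁^{-1} - (q^{-1/2}x₁)^{⌊-2y₁⌋_o})/(1 - q x₁^{-2}))·x^y`. -/
def nabla0oEl (qh : F) (y : E r) : QA F r :=
  (qh • X F r ((-1 : ℝ) • epsV r 1)) *
    geomS F r (qh * qh) ((-2 : ℝ) • epsV r 1) ((-floorO (-2 * cd r y 1) - 1) / 2) * X F r y

/-- The value of `T₀^𝒪` on `x^y`. -/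
def T0el (qh : Fˣ) (k0 u0 : F) (t : Fin r → Fˣ) (y : E r) : QA F r :=
  (k0 ^ chiE (2 * cd r y 1) * u0 ^ chiO (2 * cd r y 1) *
      ((tcU F r (torusAct F r qh (gfun r y) t) 1 : Fˣ) : F)) • X F r (sEps1 r y)
    + (k0 - k0⁻¹) • nabla0eEl F r qh y + (u0 - u0⁻¹) • nabla0oEl F r qh y

/-- The operator `T₀^𝒪` (as a globally defined operator; on `F[𝒪]` it is the operator of
the quasi-polynomial representation). -/
def T0op (qh : Fˣ) (k0 u0 : F) (t : Fin r → Fˣ) : Module.End F (QA F r) :=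
  mkOp F r (T0el F r qh k0 u0 t)

/-- The full family `T₀^𝒪, T₁, …, T_r`. -/
def Tfull (qh : Fˣ) (k0 u0 k kr ur : F) (t : Fin r → Fˣ) (j : ℕ) : Module.End F (QA F r) :=
  if j = 0 then T0op F r qh k0 u0 t else Top F r k kr ur j

/-- The Hecke parameter `k_j` (`k₀`, `k` or `k_r`). -/
def kpar (k0 k kr : F) (j : ℕ) : F := if j = 0 then k0 else if j = r then kr else k

/-- `(T_j^𝒪)⁻¹ = T_j^𝒪 - k_j + k_j⁻¹` (the inverse on `F[𝒪]`, by the Hecke relation). -/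
def TfullInv (qh : Fˣ) (k0 u0 k kr ur : F) (t : Fin r → Fˣ) (j : ℕ) : Module.End F (QA F r) :=
  Tfull F r qh k0 u0 k kr ur t j - (kpar F r k0 k kr j - (kpar F r k0 k kr j)⁻¹) • 1

/-- The word `0, 1, …, r-1, r, r-1, …, i` used in the definition of `Y_i^𝒪`. -/
def Ylist (i : ℕ) : List ℕ :=
  0 :: (((List.range (r - 1)).map (· + 1)) ++ [r] ++ ((List.range (r - i)).map fun m => r - 1 - m))

/-- The commuting operators
`Y_i^𝒪 = (T_{i-1}^𝒪)⁻¹⋯(T₁^𝒪)⁻¹ · T₀^𝒪 · T₁^𝒪⋯T_{r-1}^𝒪 · T_r^𝒪 · T_{r-1}^𝒪⋯T_i^𝒪`. -/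
def Yop (qh : Fˣ) (k0 u0 k kr ur : F) (t : Fin r → Fˣ) (i : ℕ) : Module.End F (QA F r) :=
  ((((List.range (i - 1)).map (· + 1)).reverse.map (TfullInv F r qh k0 u0 k kr ur t)).prod) *
    (((Ylist r i).map (Tfull F r qh k0 u0 k kr ur t)).prod)

/-! ### The base points `𝔰^𝒪`, `𝔰_y` and the spectrum -/

/-- `n_i^𝒪` (with `c = c^𝒪`), resp. `m_i(y)` (with `c = y`). -/
def nO (c : E r) (m : Fin r) : ℤ :=
  (∑ j : Fin r, if m < j then eta (c m - c j) + eta (c m + c j) else 0) +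
    ∑ j : Fin r, if j < m then eta (c j + c m) - eta (c j - c m) else 0

/-- The base point `𝔰^𝒪 ∈ T`. -/
def sOtor (k0 u0 k kr ur : Fˣ) (O : Set (E r)) : Fin r → Fˣ := fun m =>
  (k0 * kr) ^ (-(chiE (2 * cpt r O m) : ℤ)) * (u0 * ur) ^ (chiO (2 * cpt r O m) : ℤ) *
    k ^ nO r (cpt r O) m

/-- The eigenvalue `γ_i^𝒪(y) = ((g_y(𝔰^𝒪·t))_i)⁻¹`. -/
def gammaO (qh k0 u0 k kr ur : Fˣ) (O : Set (E r)) (t : Fin r → Fˣ) (i : ℕ) (y : E r) : Fˣ :=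
  (tcU F r (torusAct F r qh (gfun r y) fun m => sOtor F r k0 u0 k kr ur O m * t m) i)⁻¹

/-- `𝔰_y ∈ T`. -/
def sfrak (k0 u0 k kr ur : Fˣ) (y : E r) : Fin r → Fˣ := fun m =>
  (k0 * kr) ^ etaE (2 * y m) * (u0 * ur) ^ etaO (2 * y m) * k ^ nO r y m

/-! ### Finite Weyl group combinatorics, positive roots -/

/-- The set of positive roots of type `C_r`. -/
def PhiPlus : Set (E r) :=
  {v | (∃ a b : Fin r, a < b ∧ v = eV r a - eV r b) ∨
       (∃ a b : Fin r, a < b ∧ v = eV r a + eV r b) ∨ ∃ a : Fin r, v = (2 : ℝ) • eV r a}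

/-- The root system of type `C_r`. -/
def Phi0 : Set (E r) := PhiPlus r ∪ {v | -v ∈ PhiPlus r}

/-- The normalisation factor `κ_w^𝒪 = ∏_{α ∈ Π(w)} 𝐤_α^{χ_e(α(c))}·𝐤_{α/2}^{-χ_o(α(c))}`,
where `Π(w) = {α ∈ Φ₀⁺ : wα ∈ -Φ₀⁺}`, `𝐤_α = 𝐤_{α/2} = k` for short roots and
`𝐤_α = k_r`, `𝐤_{α/2} = u_r` for long roots. -/
def kappaW (k kr ur : Fˣ) (w : E r → E r) (c : E r) : Fˣ :=
  (∏ p : Fin r × Fin r,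
      if p.1 < p.2 ∧ -w (eV r p.1 - eV r p.2) ∈ PhiPlus r then
        k ^ ((chiE (ip r (eV r p.1 - eV r p.2) c) : ℤ) - (chiO (ip r (eV r p.1 - eV r p.2) c) : ℤ))
      else 1) *
  (∏ p : Fin r × Fin r,
      if p.1 < p.2 ∧ -w (eV r p.1 + eV r p.2) ∈ PhiPlus r then
        k ^ ((chiE (ip r (eV r p.1 + eV r p.2) c) : ℤ) - (chiO (ip r (eV r p.1 + eV r p.2) c) : ℤ))
      else 1) *
  ∏ a : Fin r,
      if -w ((2 : ℝ) • eV r a) ∈ PhiPlus r then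
        kr ^ (chiE (ip r ((2 : ℝ) • eV r a) c) : ℤ) * ur ^ (-(chiO (ip r ((2 : ℝ) • eV r a) c) : ℤ))
      else 1

/-- Iterated application `T_{i₁}(T_{i₂}(⋯(T_{i_ℓ}(f))⋯))`. -/
def applyT (k kr ur : F) (l : List ℕ) (f : QA F r) : QA F r :=
  l.foldr (fun i g => Top F r k kr ur i g) f

/-- The length function of the finite Weyl group `W₀`. -/
def w0len (g : E r → E r) : ℕ :=
  sInf {n | ∃ l : List ℕ, (∀ a ∈ l, 1 ≤ a ∧ a ≤ r) ∧ l.length = n ∧ (fun y => wordAct r l y) = g}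

/-- Membership in `W₀` (as maps on `ℝ^r`). -/
def IsW0fun (w : E r → E r) : Prop :=
  ∃ l : List ℕ, (∀ a ∈ l, 1 ≤ a ∧ a ≤ r) ∧ w = fun y => wordAct r l y

/-- Membership in the parabolic subgroup `W_{0,𝒪}` generated by the `s_i`, `1 ≤ i ≤ r`,
with `α_i(c^𝒪) = 0`. -/
def IsWOOfun (O : Set (E r)) (u : E r → E r) : Prop :=
  ∃ l : List ℕ, (∀ a ∈ l, 1 ≤ a ∧ a ≤ r ∧ alphaF r a (cpt r O) = 0) ∧
    u = fun y => wordAct r l y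

/-- `v ∈ W₀^𝒪`: `v ∈ W₀` of minimal length in its coset `v·W_{0,𝒪}`. -/
def MinRep (O : Set (E r)) (v : E r → E r) : Prop :=
  IsW0fun r v ∧ ∀ u, IsWOOfun r O u → w0len r v ≤ w0len r fun y => v (u y)

/-- Membership in the affine Weyl group `W` (as maps on `ℝ^r`). -/
def IsWfun (g : E r → E r) : Prop :=
  ∃ l : List ℕ, (∀ a ∈ l, a ≤ r) ∧ g = fun y => wordAct r l y

/-- Membership in the parabolic subgroup `W_{J(𝒪)}` generated by the `s_j`, `j ∈ J(𝒪)`. -/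
def IsWJfun (O : Set (E r)) (u : E r → E r) : Prop :=
  ∃ l : List ℕ, (∀ a ∈ l, a ≤ r ∧ alphaF r a (cpt r O) = 0) ∧ u = fun y => wordAct r l y

/-- The `W`-action on the Laurent polynomials `F[ℤ^r]` by `q`-dilations and reflections:
`w(x^μ) = x^{wμ}` for `w ∈ W₀`, `τ(λ)(x^μ) = q^{-⟨μ,λ⟩} x^μ` (globally defined via the
linear/translation parts of `g`). -/
def LWact (qh : Fˣ) (g : E r → E r) : Module.End F (QA F r) :=
  mkOp F r fun v => (((qh * qh) ^ (-⌊ip r (g v - g 0) (g 0)⌋) : Fˣ) : F) • X F r (g v - g 0)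

/-! ### roots `ᾱ_j`, torus reflections -/

/-- The finite simple roots `ᾱ₀ = -2ε₁`, `ᾱ_i = ε_i - ε_{i+1}`, `ᾱ_r = 2ε_r`
(as integral vectors). -/
def abarI (j : ℕ) : Fin r → ℤ := fun m =>
  if j = 0 then (if (m : ℕ) = 0 then -2 else 0)
  else if j = r then (if (m : ℕ) + 1 = r then 2 else 0)
  else if (m : ℕ) + 1 = j then 1
  else if (m : ℕ) = j then -1
  else 0

/-- The corresponding coroots `ᾱ₀^∨ = -ε₁`, `ᾱ_i^∨ = ε_i - ε_{i+1}`, `ᾱ_r^∨ = ε_r`. -/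
def abarV (j : ℕ) : Fin r → ℤ := fun m =>
  if j = 0 then (if (m : ℕ) = 0 then -1 else 0)
  else if j = r then (if (m : ℕ) + 1 = r then 1 else 0)
  else if (m : ℕ) + 1 = j then 1
  else if (m : ℕ) = j then -1
  else 0

/-- `ᾱ_j` as a real vector. -/
def abarR (j : ℕ) : E r := fun m => ((abarI r j m : ℤ) : ℝ)

/-- The constants `c₀ = u₀u_r`, `c_i = k²`, `c_r = k₀k_r`. -/
def cpar (k0 u0 k kr ur : Fˣ) (j : ℕ) : Fˣ :=
  if j = 0 then u0 * ur else if j = r then k0 * kr else k * k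

/-- The action of the reflection `s_{ᾱ_j} ∈ W₀` on the torus `T` (with `s_{ᾱ₀} = s_{ε₁}`). -/
def sTor (j : ℕ) (t : Fin r → Fˣ) : Fin r → Fˣ := fun m =>
  if j = 0 then (if (m : ℕ) = 0 then (t m)⁻¹ else t m)
  else if j = r then (if (m : ℕ) + 1 = r then (t m)⁻¹ else t m)
  else if (m : ℕ) + 1 = j then tcU F r t (j + 1)
  else if (m : ℕ) = j then tcU F r t j
  else t m

/-! ### The operators `G_t^𝒪(a)` for affine roots `a = (α, n)` -/

/-- The coroot `α^∨ = 2α/⟨α,α⟩`. -/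
def coroot (v : E r) : E r := ((2 : ℝ) / ip r v v) • v

/-- The scalar `q^{2n/⟨α,α⟩}` appearing in `x^{a^∨}` for `a = (α,n)`. -/
def qsc (qh : Fˣ) (v : E r) (n : ℤ) : Fˣ := if ip r v v = 4 then qh ^ n else (qh * qh) ^ n

/-- `𝐤_a`: `k` if `α` is short; `k_r` if `α` long, `n` even; `k₀` if `α` long, `n` odd. -/
def kaf (k0 k kr : Fˣ) (v : E r) (n : ℤ) : Fˣ :=
  if ip r v v = 4 then (if Even n then kr else k0) else k

/-- `𝐤_{a/2}`: `k` if `α` is short; `u_r` if `α` long, `n` even; `u₀` if `α` long, `n` odd. -/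
def khaf (u0 k ur : Fˣ) (v : E r) (n : ℤ) : Fˣ :=
  if ip r v v = 4 then (if Even n then ur else u0) else k

/-- The reflection `s_α(y) = y - α(y)·α^∨`. -/
def sRefl (v y : E r) : E r := y - ip r v y • coroot r v

/-- `s_{a,t}(x^y) = (g_y t)^{-n α^∨} · x^{s_α y}`. -/
def saTel (qh : Fˣ) (t : Fin r → Fˣ) (v : E r) (n : ℤ) (y : E r) : QA F r :=
  ((upowR F r (torusAct F r qh (gfun r y) t) (((-n : ℤ) : ℝ) • coroot r v) : Fˣ) : F) •
    X F r (sRefl r v y)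

/-- The twisted reflection operator `s_{a,t}`. -/
def SaOp (qh : Fˣ) (t : Fin r → Fˣ) (v : E r) (n : ℤ) : Module.End F (QA F r) :=
  mkOp F r (saTel F r qh t v n)

/-- The value `G_t^𝒪(a)(x^y)` for the affine root `a = (v, n)`. -/
def Gel (qh k0 u0 k kr ur : Fˣ) (t : Fin r → Fˣ) (v : E r) (n : ℤ) (y : E r) : QA F r :=
  (((kaf F r k0 k kr v n : Fˣ) : F) ^ chiE (ip r v y) *
      ((khaf F r u0 k ur v n : Fˣ) : F) ^ chiO (ip r v y)) • X F r y
    + ((((kaf F r k0 k kr v n : Fˣ) : F) - ((kaf F r k0 k kr v n : Fˣ) : F)⁻¹) •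
          geomS F r (((qsc F r qh v n)⁻¹ * (qsc F r qh v n)⁻¹ : Fˣ) : F)
            ((-2 : ℝ) • coroot r v) (-floorE (ip r v y) / 2)
        + (((khaf F r u0 k ur v n : Fˣ) : F) - ((khaf F r u0 k ur v n : Fˣ) : F)⁻¹) •
          ((((qsc F r qh v n)⁻¹ : Fˣ) : F) • X F r ((-1 : ℝ) • coroot r v) *
            geomS F r (((qsc F r qh v n)⁻¹ * (qsc F r qh v n)⁻¹ : Fˣ) : F)
              ((-2 : ℝ) • coroot r v) (-(floorO (ip r v y) + 1) / 2))) *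
      saTel F r qh t v n y

/-- The operator `G_t^𝒪(a)` for `a = (v, n)`. -/
def Gop (qh k0 u0 k kr ur : Fˣ) (t : Fin r → Fˣ) (v : E r) (n : ℤ) : Module.End F (QA F r) :=
  mkOp F r (Gel F r qh k0 u0 k kr ur t v n)

/-- The twisted action `g_t` of `g ∈ W` on `F[𝒪]`:
`g_t(x^y) = (g_{w₀ y} t)^{-λ} x^{w₀ y}` for `g = τ(λ) w₀`. -/
def Wtw (qh : Fˣ) (t : Fin r → Fˣ) (g : E r → E r) : Module.End F (QA F r) :=
  mkOp F r fun y =>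
    (((upowR F r (torusAct F r qh (gfun r (g y - g 0)) t) (g 0))⁻¹ : Fˣ) : F) •
      X F r (g y - g 0)

/-! ### The operators `D_j` -/

/-- The palindromic word `1, …, r-1, r, r-1, …, 1`. -/
def palin : List ℕ :=
  ((List.range (r - 1)).map (· + 1)) ++ [r] ++ ((List.range (r - 1)).map (· + 1)).reverse

/-- Multiplication by `x^{-ε₁}`. -/
def Mop : Module.End F (QA F r) := mkOp F r fun y => X F r ((-1 : ℝ) • epsV r 1) * X F r y

/-- `D₀ = (T₁^𝒪 ⋯ T_{r-1}^𝒪 T_r^𝒪 T_{r-1}^𝒪 ⋯ T₁^𝒪)⁻¹ ∘ M`. -/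
def D0op (qh : Fˣ) (k0 u0 k kr ur : F) (t : Fin r → Fˣ) : Module.End F (QA F r) :=
  ((palin r).map (TfullInv F r qh k0 u0 k kr ur t)).prod * Mop F r

/-- `D_j`: `D₀` for `j = 0` and `T_j^𝒪` for `1 ≤ j ≤ r`. -/
def Dop (qh : Fˣ) (k0 u0 k kr ur : F) (t : Fin r → Fˣ) (j : ℕ) : Module.End F (QA F r) :=
  if j = 0 then D0op F r qh k0 u0 k kr ur t else Tfull F r qh k0 u0 k kr ur t j

/-- Iterated application `D_{j₁}(D_{j₂}(⋯(D_{j_ℓ}(f))⋯))`. -/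
def applyD (qh : Fˣ) (k0 u0 k kr ur : F) (t : Fin r → Fˣ) (l : List ℕ) (f : QA F r) : QA F r :=
  l.foldr (fun j g => Dop F r qh k0 u0 k kr ur t j g) f

/-- The coefficients `k_{s_j}(y)`. -/
def ksj (k kr ur : Fˣ) (j : ℕ) (y : E r) : Fˣ :=
  if j = 0 then
    kr ^ (-etaE (2 * cd r y 1)) * ur ^ (-etaO (2 * cd r y 1)) *
      ∏ m : Fin r,
        (if 1 ≤ (m : ℕ) then k ^ (-eta (cd r y 1 - y m) - eta (cd r y 1 + y m)) else 1)
  else if j = r then kr ^ (-etaE (2 * cd r y r)) * ur ^ (-etaO (2 * cd r y r))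
  else k ^ (-eta (cd r y j - cd r y (j + 1)))

/-- `k_w(c) = ∏_m k_{s_{j_m}}(s_{j_{m+1}} ⋯ s_{j_ℓ} c)` for the word `w = s_{j₁} ⋯ s_{j_ℓ}`. -/
def kword (k kr ur : Fˣ) (l : List ℕ) (z : E r) : Fˣ :=
  (l.foldr (fun j p => (genF r j p.1, ksj F r k kr ur j p.1 * p.2)) (z, (1 : Fˣ))).2


/-! ### Proof: noncommutative algebra -/

section Alg
variable {K R : Type*} [Field K] [Ring R] [Algebra K R]

lemma alg_A_RA (a : K) (A B : R) (hA : A * A = a • A + 1) (hB : B * B = a • B + 1) :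
    (A * B * A - B * A * B) * A = -((B - a • 1) * (A * B * A - B * A * B)) := by
  have e1 : A * B * A * A = A * B * (A * A) := by noncomm_ring
  have e2 : B * (B * A * B) = (B * B) * A * B := by noncomm_ring
  rw [sub_mul, e1, sub_mul B, mul_sub B, e2, hA, hB]
  simp only [mul_add, add_mul, mul_sub, smul_mul_assoc, mul_smul_comm, mul_one, one_mul, mul_assoc]
  abel

lemma alg_C_RA (a : K) (A B : R) (hA : A * A = a • A + 1) :
    (A * B * A * B - B * A * B * A) * A = -((A - a • 1) * (A * B * A * B - B * A * B * A)) := by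
  have e1 : B * A * B * A * A = B * A * B * (A * A) := by noncomm_ring
  have e2 : A * (A * B * A * B) = (A * A) * B * A * B := by noncomm_ring
  rw [sub_mul, e1, sub_mul A, mul_sub A, e2, hA]
  simp only [mul_add, add_mul, mul_sub, smul_mul_assoc, mul_smul_comm, mul_one, one_mul, mul_assoc]
  abel

lemma alg_D_RA (a : K) (A B : R) (hA : A * A = a • A + 1) :
    (A * B - B * A) * A = -((A - a • 1) * (A * B - B * A)) := by
  have e1 : B * A * A = B * (A * A) := by noncomm_ring
  have e2 : A * (A * B) = (A * A) * B := by noncomm_ring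
  rw [sub_mul, e1, sub_mul A, mul_sub A, e2, hA]
  simp only [mul_add, add_mul, mul_sub, smul_mul_assoc, mul_smul_comm, mul_one, one_mul, mul_assoc]
  abel

lemma alg_inv (a : K) (A : R) (hA : A * A = a • A + 1) :
    A * (A - a • 1) = 1 ∧ (A - a • 1) * A = 1 := by
  constructor
  · rw [mul_sub, hA]; simp
  · rw [sub_mul, hA]; simp

/-- From `R A = - B' R` to `R A' = - B R`. -/
lemma alg_RAinv {A A' B B' S : R} (hA : A * A' = 1) (hB : B * B' = 1)
    (h : S * A = -(B' * S)) : S * A' = -(B * S) := by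
  have : B * (S * A) * A' = B * (-(B' * S)) * A' := by rw [h]
  have h1 : B * (S * A) * A' = B * S * (A * A') := by noncomm_ring
  have h2 : B * (-(B' * S)) * A' = -((B * B') * S * A') := by noncomm_ring
  rw [h1, h2, hA, hB] at this
  simp only [mul_one, one_mul] at this
  rw [this, neg_neg]

lemma alg_A_x1 {A A' B B' x1 x2 x3 : R} (hA : A * A' = 1) (hA' : A' * A = 1)
    (hB : B * B' = 1) (hB' : B' * B = 1)
    (hRA : (A * B * A - B * A * B) * A = -(B' * (A * B * A - B * A * B)))
    (hRB : (B * A * B - A * B * A) * B = -(A' * (B * A * B - A * B * A)))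
    (h1 : A * x1 = x2 * A') (h2 : B * x2 = x3 * B') (h3 : B * x1 = x1 * B)
    (h4 : A * x3 = x3 * A) :
    (A * B * A - B * A * B) * x1 = x3 * (A * B * A - B * A * B) := by
  have i1 : (A * B * A - B * A * B) * A' = -(B * (A * B * A - B * A * B)) :=
    alg_RAinv hA hB hRA
  have i2 : (A * B * A - B * A * B) * B' = -(A * (A * B * A - B * A * B)) := by
    have := alg_RAinv hB hA hRB
    rw [← neg_sub (A * B * A)] at this
    simpa only [neg_mul, mul_neg, neg_inj] using this
  have e1 : A * B * A * x1 = x3 * (A * B' * A') := by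
    calc A * B * A * x1 = A * B * (A * x1) := by noncomm_ring
      _ = A * (B * x2) * A' := by rw [h1]; noncomm_ring
      _ = (A * x3) * B' * A' := by rw [h2]; noncomm_ring
      _ = _ := by rw [h4]; noncomm_ring
  have e2 : B * A * B * x1 = x3 * (B' * A' * B) := by
    calc B * A * B * x1 = B * A * (B * x1) := by noncomm_ring
      _ = B * (A * x1) * B := by rw [h3]; noncomm_ring
      _ = (B * x2) * A' * B := by rw [h1]; noncomm_ring
      _ = _ := by rw [h2]; noncomm_ring
  have e3 : A * B' * A' = B' * A' * (A * B * A) * B' * A' := by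
    calc A * B' * A' = B' * B * A * B' * A' := by rw [hB', one_mul]
      _ = B' * (A' * A) * B * A * B' * A' := by rw [hA', mul_one]
      _ = _ := by noncomm_ring
  have e4 : B' * A' * B = B' * A' * (B * A * B) * B' * A' := by
    calc B' * A' * B = B' * A' * B * (A * (B * B') * A') := by rw [hB, mul_one, hA, mul_one]
      _ = _ := by noncomm_ring
  rw [sub_mul, e1, e2, ← mul_sub, e3, e4]
  congr 1
  calc _ = B' * A' * ((A * B * A - B * A * B) * B') * A' := by noncomm_ring
    _ = -(B' * (A' * A) * ((A * B * A - B * A * B) * A')) := by rw [i2]; noncomm_ring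
    _ = (B' * B) * (A * B * A - B * A * B) := by rw [i1, hA']; noncomm_ring
    _ = _ := by rw [hB', one_mul]

lemma alg_C_x1 (c : K) {A A' B B' x1 x1' x2 x2' : R} (hA : A * A' = 1) (hA' : A' * A = 1)
    (hB : B * B' = 1) (hB' : B' * B = 1)
    (hRA : (A * B * A * B - B * A * B * A) * A = -(A' * (A * B * A * B - B * A * B * A)))
    (hRB : (A * B * A * B - B * A * B * A) * B = -(B' * (A * B * A * B - B * A * B * A)))
    (h1 : A * x1 = x2 * A') (h2 : B * x2 = x2' * B' - c • 1) (h3 : B * x1 = x1 * B)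
    (h3' : B * x1' = x1' * B) (h4 : A * x2' = x1' * A') :
    (A * B * A * B - B * A * B * A) * x1 = x1' * (A * B * A * B - B * A * B * A) := by
  have i1 := alg_RAinv hA hA hRA
  have i2 := alg_RAinv hB hB hRB
  have e1 : A * B * A * B * x1 = x1' * (A' * B' * A' * B) - c • B := by
    calc A * B * A * B * x1 = A * B * A * (B * x1) := by noncomm_ring
      _ = A * B * (A * x1) * B := by rw [h3]; noncomm_ring
      _ = A * (B * x2) * A' * B := by rw [h1]; noncomm_ring
      _ = (A * x2') * B' * A' * B - c • ((A * A') * B) := by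
          rw [h2]; simp only [mul_sub, sub_mul, smul_mul_assoc, mul_smul_comm, mul_one, mul_assoc]
      _ = _ := by rw [h4, hA, one_mul]; noncomm_ring
  have e2 : B * A * B * A * x1 = x1' * (B * A' * B' * A') - c • B := by
    calc B * A * B * A * x1 = B * A * B * (A * x1) := by noncomm_ring
      _ = B * A * (B * x2) * A' := by rw [h1]; noncomm_ring
      _ = B * (A * x2') * B' * A' - c • (B * (A * A')) := by
          rw [h2]; simp only [mul_sub, sub_mul, smul_mul_assoc, mul_smul_comm, mul_one, mul_assoc]
      _ = (B * x1') * A' * B' * A' - c • B := by rw [h4, hA, mul_one]; noncomm_ring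
      _ = _ := by rw [h3']; noncomm_ring
  have e3 : A' * B' * A' * B = A' * B' * A' * (B * A * B * A) * A' * B' * A' := by
    calc A' * B' * A' * B = A' * B' * A' * B * (A * (B * (A * A') * B') * A') := by
          rw [hA, mul_one, hB, mul_one, hA, mul_one]
      _ = _ := by noncomm_ring
  have e4 : B * A' * B' * A' = A' * B' * A' * (A * B * A * B) * A' * B' * A' := by
    calc B * A' * B' * A' = (A' * (B' * (A' * A) * B) * A) * B * A' * B' * A' := by
          rw [hA', mul_one, hB', mul_one, hA', one_mul]
      _ = _ := by noncomm_ring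
  rw [sub_mul, e1, e2, sub_sub_sub_cancel_right, ← mul_sub, e3, e4]
  congr 1
  calc _ = -(A' * B' * A' * ((A * B * A * B - B * A * B * A) * A') * B' * A') := by noncomm_ring
    _ = A' * B' * (A' * A) * ((A * B * A * B - B * A * B * A) * B') * A' := by
        rw [i1]; noncomm_ring
    _ = - (A' * (B' * B) * ((A * B * A * B - B * A * B * A) * A')) := by
        rw [i2, hA']; noncomm_ring
    _ = (A' * A) * (A * B * A * B - B * A * B * A) := by rw [i1, hB']; noncomm_ring
    _ = _ := by rw [hA', one_mul]

end Alg

lemma neg_out {R : Type*} [Ring R] {S A B : R} (h : S * A = -(B * S)) : S * A = (-B) * S := by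
  rw [h, neg_mul]

lemma neg_swap {R : Type*} [Ring R] {P Q B B' : R} (h : (P - Q) * B = -(B' * (P - Q))) :
    (Q - P) * B = -(B' * (Q - P)) := by
  rw [← neg_sub P Q, neg_mul, h, mul_neg]

lemma neg_swap_pos {R : Type*} [Ring R] {P Q x x' : R} (h : (P - Q) * x = x' * (P - Q)) :
    (Q - P) * x = x' * (Q - P) := by
  rw [← neg_sub P Q, neg_mul, h, mul_neg]

/-! ### Proof: coordinates -/

section Ops
variable {F : Type*} [Field F] {r : ℕ}

lemma cd_coe (y : E r) (m : Fin r) : cd r y ((m : ℕ) + 1) = y m := by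
  unfold cd
  rw [Finset.sum_eq_single m]
  · simp
  · intro b _ hb
    rw [if_neg]
    intro h
    exact hb (Fin.ext (by omega))
  · simp

lemma cd_ext {y z : E r} (h : ∀ j, 1 ≤ j → j ≤ r → cd r y j = cd r z j) : y = z := by
  funext m
  rw [← cd_coe y m, ← cd_coe z m]
  exact h _ (by omega) (by have := m.2; omega)

lemma cd_fun (y : E r) {j : ℕ} (h1 : 1 ≤ j) (h2 : j ≤ r) :
    cd r y j = y ⟨j - 1, by omega⟩ := by
  rw [← cd_coe y ⟨j - 1, by omega⟩]
  congr 1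
  simp only
  omega

lemma cd_add (y z : E r) (j : ℕ) : cd r (y + z) j = cd r y j + cd r z j := by
  unfold cd
  rw [← Finset.sum_add_distrib]
  exact Finset.sum_congr rfl fun m _ => by split_ifs <;> simp

lemma cd_neg (y : E r) (j : ℕ) : cd r (-y) j = -cd r y j := by
  unfold cd
  rw [← Finset.sum_neg_distrib]
  exact Finset.sum_congr rfl fun m _ => by split_ifs <;> simp

lemma cd_sub (y z : E r) (j : ℕ) : cd r (y - z) j = cd r y j - cd r z j := by
  rw [sub_eq_add_neg, cd_add, cd_neg, sub_eq_add_neg]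

lemma cd_smul (c : ℝ) (y : E r) (j : ℕ) : cd r (c • y) j = c * cd r y j := by
  unfold cd
  rw [Finset.mul_sum]
  exact Finset.sum_congr rfl fun m _ => by split_ifs <;> simp

lemma cd_eps (i : ℕ) {j : ℕ} (h1 : 1 ≤ j) (h2 : j ≤ r) :
    cd r (epsV r i) j = if j = i then 1 else 0 := by
  rw [cd_fun _ h1 h2]
  unfold epsV
  simp only [Nat.sub_add_cancel h1]

lemma cd_sr (y : E r) {j : ℕ} (h1 : 1 ≤ j) (h2 : j ≤ r) :
    cd r (sW r r y) j = if j = r then -cd r y j else cd r y j := by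
  rw [cd_fun _ h1 h2, cd_fun _ h1 h2]
  unfold sW
  simp only [Nat.sub_add_cancel h1, if_true]

lemma cd_si (y : E r) {i j : ℕ} (hi : i < r) (h1 : 1 ≤ j) (h2 : j ≤ r) :
    cd r (sW r i y) j =
      if j = i then cd r y (i + 1) else if j = i + 1 then cd r y i else cd r y j := by
  rw [cd_fun _ h1 h2]
  unfold sW
  have e : (j - 1 = i) = (j = i + 1) := by apply propext; omega
  simp only [Nat.sub_add_cancel h1, if_neg hi.ne, e]
  split_ifs
  · rfl
  · rfl
  · rw [cd_fun _ h1 h2]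

/-! ### Monomials, geometric series -/

lemma X_mul (y z : E r) : X F r y * X F r z = X F r (y + z) := by
  unfold X
  rw [AddMonoidAlgebra.single_mul_single, one_mul]

lemma X_zero : X F r 0 = 1 := rfl

lemma geom_zero (v : E r) : geomS F r 1 v 0 = 0 := by simp [geomS]

lemma geom_succ (v : E r) (m : ℤ) :
    geomS F r 1 v (m + 1) = 1 + X F r v * geomS F r 1 v m := by
  unfold geomS
  simp only [one_zpow, one_smul]
  rcases lt_trichotomy m (-1) with h | h | h
  · rw [if_neg (by omega), if_neg (by omega)]
    obtain ⟨n, rfl⟩ : ∃ n : ℕ, m = -(n : ℤ) - 2 := ⟨(-m - 2).toNat, by omega⟩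
    have e1 : (-(-(n : ℤ) - 2 + 1)).toNat = n + 1 := by omega
    have e2 : (-(-(n : ℤ) - 2)).toNat = n + 1 + 1 := by omega
    rw [e1, e2, Finset.sum_range_succ' _ (n + 1), mul_neg, mul_add, Finset.mul_sum]
    have e3 : X F r v * X F r ((-((0 : ℕ) : ℝ) - 1) • v) = 1 := by
      rw [X_mul, ← X_zero]; congr 1; simp
    rw [e3, neg_add, add_comm 1, add_assoc, neg_add_cancel, add_zero]
    congr 1
    refine Finset.sum_congr rfl fun t _ => ?_
    rw [X_mul]; congr 1
    push_cast
    module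
  · subst h
    simp [X_mul, X_zero]
  · rw [if_pos (by omega), if_pos (by omega)]
    obtain ⟨n, rfl⟩ : ∃ n : ℕ, m = n := ⟨m.toNat, by omega⟩
    have e1 : ((n : ℤ) + 1).toNat = n + 1 := by omega
    rw [e1, Int.toNat_natCast, Finset.sum_range_succ', Finset.mul_sum, add_comm]
    congr 1
    · simp [X_zero]
    · refine Finset.sum_congr rfl fun t _ => ?_
      rw [X_mul]; congr 1
      push_cast
      module

lemma geom_one (v : E r) : geomS F r 1 v 1 = 1 := by
  have := geom_succ (F := F) v 0
  rwa [geom_zero, mul_zero, add_zero, zero_add] at this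

lemma geom_pred (v : E r) (m : ℤ) :
    geomS F r 1 v (m - 1) = X F r (-v) * (geomS F r 1 v m - 1) := by
  have := geom_succ (F := F) v (m - 1)
  rw [sub_add_cancel] at this
  rw [this, add_sub_cancel_left, ← mul_assoc, X_mul, neg_add_cancel, X_zero, one_mul]

lemma geom_neg_one (v : E r) : geomS F r 1 v (-1) = -X F r (-v) := by
  have := geom_pred (F := F) v 0
  rw [geom_zero] at this
  simpa using this

/-! ### Operators -/

lemma mkOp_X (Ψ : E r → QA F r) (y : E r) : mkOp F r Ψ (X F r y) = Ψ y := by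
  simp [mkOp, X]

lemma op_ext {P Q : Module.End F (QA F r)} (h : ∀ y, P (X F r y) = Q (X F r y)) : P = Q := by
  refine AddMonoidAlgebra.lhom_ext' fun y => ?_
  refine LinearMap.ext_ring ?_
  exact h y

/-- Multiplication by a monomial. -/
def Mx (y : E r) : Module.End F (QA F r) := LinearMap.mulLeft F (X F r y)

lemma Mx_apply (y : E r) (f : QA F r) : Mx y f = X F r y * f := rfl

lemma Mx_add (y z : E r) : Mx (F := F) (y + z) = Mx y * Mx z := by
  refine LinearMap.ext fun f => ?_
  simp [Mx_apply, ← X_mul, mul_assoc]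

lemma Mx_zero : Mx (F := F) (0 : E r) = 1 := by
  refine LinearMap.ext fun f => ?_
  simp [Mx_apply, X_zero]

lemma Mx_neg_mul (y : E r) : Mx (F := F) (-y) * Mx y = 1 := by
  rw [← Mx_add, neg_add_cancel, Mx_zero]

lemma Mx_mul_neg (y : E r) : Mx (F := F) y * Mx (-y) = 1 := by
  rw [← Mx_add, add_neg_cancel, Mx_zero]

lemma chiZ_int (z : ℝ) (n : ℤ) : chiZ (z + n) = chiZ z := by
  unfold chiZ
  congr 1
  apply propext
  constructor
  · rintro ⟨m, h⟩; exact ⟨m - n, by push_cast; linarith⟩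
  · rintro ⟨m, h⟩; exact ⟨m + n, by push_cast; linarith⟩

lemma chiE_int (z : ℝ) (n : ℤ) : chiE (z + 2 * n) = chiE z := by
  unfold chiE
  congr 1
  apply propext
  constructor
  · rintro ⟨m, h⟩; exact ⟨m - n, by push_cast; linarith⟩
  · rintro ⟨m, h⟩; exact ⟨m + n, by push_cast; linarith⟩

lemma chiO_int (z : ℝ) (n : ℤ) : chiO (z + 2 * n) = chiO z := by
  unfold chiO
  congr 1
  apply propext
  constructor
  · rintro ⟨m, h⟩; exact ⟨m - n, by push_cast; linarith⟩
  · rintro ⟨m, h⟩; exact ⟨m + n, by push_cast; linarith⟩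

variable (k kr ur : F)

lemma Top_i {i : ℕ} (hi : i < r) (y : E r) : Top F r k kr ur i (X F r y) =
    k ^ chiZ (cd r y i - cd r y (i + 1)) • X F r (sW r i y)
      + (k - k⁻¹) • (geomS F r 1 (epsV r i - epsV r (i + 1))
        (-⌊cd r y i - cd r y (i + 1)⌋) * X F r y) := by
  rw [Top, mkOp_X, Tel, if_neg hi.ne, nablaIel]

lemma Top_r (y : E r) : Top F r k kr ur r (X F r y) =
    (kr ^ chiE (2 * cd r y r) * ur ^ chiO (2 * cd r y r)) • X F r (sW r r y)
      + (kr - kr⁻¹) • (geomS F r 1 ((2 : ℝ) • epsV r r) (-⌊cd r y r⌋) * X F r y)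
      + (ur - ur⁻¹) • (X F r (epsV r r) *
        geomS F r 1 ((2 : ℝ) • epsV r r) (-⌊cd r y r + 1 / 2⌋) * X F r y) := by
  rw [Top, mkOp_X, Tel, if_pos rfl, nablaReEl, nablaRoEl]
  have e1 : -floorE (2 * cd r y r) / 2 = -⌊cd r y r⌋ := by
    unfold floorE
    rw [mul_div_cancel_left₀ _ (two_ne_zero : (2 : ℝ) ≠ 0)]
    omega
  have e2 : (-floorO (2 * cd r y r) - 1) / 2 = -⌊cd r y r + 1 / 2⌋ := by
    unfold floorO
    rw [show (2 * cd r y r + 1) / 2 = cd r y r + 1 / 2 by ring]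
    omega
  rw [e1, e2]

/-- `T_i x_i = x_{i+1} (T_i - a)`. -/
lemma rel1 {i : ℕ} (h1 : 1 ≤ i) (hi : i < r) :
    Top F r k kr ur i * Mx (epsV r i) =
      Mx (epsV r (i + 1)) * (Top F r k kr ur i - (k - k⁻¹) • 1) := by
  refine op_ext fun y => ?_
  simp only [Module.End.mul_apply, Mx_apply, LinearMap.sub_apply, LinearMap.smul_apply,
    Module.End.one_apply, X_mul]
  rw [Top_i k kr ur hi, Top_i k kr ur hi]
  have c : cd r (epsV r i + y) i - cd r (epsV r i + y) (i + 1)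
      = cd r y i - cd r y (i + 1) + (1 : ℤ) := by
    rw [cd_add, cd_add, cd_eps _ h1 hi.le, cd_eps _ (by omega) hi]
    simp; ring
  have s : sW r i (epsV r i + y) = epsV r (i + 1) + sW r i y := by
    refine cd_ext fun j h h' => ?_
    simp only [cd_add, cd_si _ hi h h', cd_eps _ h h', cd_eps _ h1 hi.le,
      cd_eps _ (show 1 ≤ i + 1 by omega) hi]
    split_ifs <;> first | omega | simp
  rw [c, s, chiZ_int, Int.floor_add_intCast, neg_add, ← sub_eq_add_neg, geom_pred]
  rw [add_sub_assoc, mul_add, mul_smul_comm, X_mul, ← smul_sub, mul_smul_comm]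
  congr 2
  have : X F r (epsV r i + y) = X F r (epsV r i) * X F r y := (X_mul _ _).symm
  rw [this]
  have e : X F r (-(epsV r i - epsV r (i + 1))) * X F r (epsV r i) = X F r (epsV r (i + 1)) := by
    rw [X_mul]; congr 1; abel
  rw [← e]; ring

/-- `T_i x_{i+1} = x_i T_i + a x_{i+1}`. -/
lemma rel2 {i : ℕ} (h1 : 1 ≤ i) (hi : i < r) :
    Top F r k kr ur i * Mx (epsV r (i + 1)) =
      Mx (epsV r i) * Top F r k kr ur i + (k - k⁻¹) • Mx (epsV r (i + 1)) := by
  refine op_ext fun y => ?_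
  simp only [Module.End.mul_apply, Mx_apply, LinearMap.add_apply, LinearMap.smul_apply,
    Module.End.one_apply, X_mul]
  rw [Top_i k kr ur hi, Top_i k kr ur hi]
  have c : cd r (epsV r (i + 1) + y) i - cd r (epsV r (i + 1) + y) (i + 1)
      = cd r y i - cd r y (i + 1) + (-1 : ℤ) := by
    rw [cd_add, cd_add, cd_eps _ h1 hi.le, cd_eps _ (by omega) hi]
    simp; ring
  have s : sW r i (epsV r (i + 1) + y) = epsV r i + sW r i y := by
    refine cd_ext fun j h h' => ?_
    simp only [cd_add, cd_si _ hi h h', cd_eps _ h h', cd_eps _ h1 hi.le,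
      cd_eps _ (show 1 ≤ i + 1 by omega) hi]
    split_ifs <;> first | omega | simp
  rw [c, s, chiZ_int, Int.floor_add_intCast, neg_add, neg_neg, geom_succ]
  rw [mul_add, mul_smul_comm, X_mul, mul_smul_comm, add_assoc, ← smul_add]
  congr 2
  have : X F r (epsV r (i + 1) + y) = X F r (epsV r (i + 1)) * X F r y := (X_mul _ _).symm
  rw [this]
  have e : X F r (epsV r i - epsV r (i + 1)) * X F r (epsV r (i + 1)) = X F r (epsV r i) := by
    rw [X_mul]; congr 1; abel
  rw [← e]; ring

/-- `T_r x_r = x_r⁻¹ (T_r - b) - c`. -/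
lemma rel3 (h1 : 1 ≤ r) :
    Top F r k kr ur r * Mx (epsV r r) =
      Mx (-epsV r r) * (Top F r k kr ur r - (kr - kr⁻¹) • 1) - (ur - ur⁻¹) • 1 := by
  refine op_ext fun y => ?_
  simp only [Module.End.mul_apply, Mx_apply, LinearMap.sub_apply, LinearMap.smul_apply,
    Module.End.one_apply, X_mul]
  rw [Top_r k kr ur, Top_r k kr ur]
  have c : cd r (epsV r r + y) r = cd r y r + (1 : ℤ) := by
    rw [cd_add, cd_eps _ h1 le_rfl]
    simp; ring
  have s : sW r r (epsV r r + y) = -epsV r r + sW r r y := by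
    refine cd_ext fun j h h' => ?_
    simp only [cd_add, cd_neg, cd_sr _ h h', cd_eps _ h h']
    split_ifs <;> first | omega | simp <;> ring
  rw [c, s, mul_add, chiE_int, chiO_int, add_right_comm (cd r y r), Int.floor_add_intCast,
    Int.floor_add_intCast, neg_add, ← sub_eq_add_neg, neg_add, ← sub_eq_add_neg,
    geom_pred, geom_pred]
  have e1 : X F r (epsV r r + y) = X F r (epsV r r) * X F r y := (X_mul _ _).symm
  have e2 : X F r (-epsV r r + sW r r y) = X F r (-epsV r r) * X F r (sW r r y) :=
    (X_mul _ _).symm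
  have e3 : X F r (-(2 : ℝ) • epsV r r) = X F r (-epsV r r) * X F r (-epsV r r) := by
    rw [X_mul]; congr 1; module
  have e4 : X F r (-epsV r r) * X F r (epsV r r) = 1 := by
    rw [X_mul, neg_add_cancel, X_zero]
  rw [← neg_smul, e1, e2, e3]
  generalize geomS F r 1 ((2 : ℝ) • epsV r r) (-⌊cd r y r⌋) = g1
  generalize geomS F r 1 ((2 : ℝ) • epsV r r) (-⌊cd r y r + 1 / 2⌋) = g2
  simp only [Algebra.smul_def]
  linear_combination (X F r (-epsV r r) * X F r y * (algebraMap F (QA F r) (kr - kr⁻¹)) *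
    (g1 - 1) +
    (algebraMap F (QA F r) (ur - ur⁻¹)) * X F r y * (X F r (-epsV r r) * X F r (epsV r r) *
    (g2 - 1) - 1)) * e4

/-- `T_i` commutes with the other variables. -/
lemma rel4 {i j : ℕ} (h1 : 1 ≤ i) (hi : i < r) (hj : j ≠ i) (hj' : j ≠ i + 1) :
    Top F r k kr ur i * Mx (epsV r j) = Mx (epsV r j) * Top F r k kr ur i := by
  refine op_ext fun y => ?_
  simp only [Module.End.mul_apply, Mx_apply, X_mul]
  rw [Top_i k kr ur hi, Top_i k kr ur hi]
  have c : cd r (epsV r j + y) i - cd r (epsV r j + y) (i + 1)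
      = cd r y i - cd r y (i + 1) := by
    rw [cd_add, cd_add, cd_eps _ h1 hi.le, cd_eps _ (by omega) hi, if_neg hj.symm,
      if_neg hj'.symm]
    simp
  have s : sW r i (epsV r j + y) = epsV r j + sW r i y := by
    refine cd_ext fun l h h' => ?_
    simp only [cd_add, cd_si _ hi h h', cd_eps _ h h', cd_eps _ h1 hi.le,
      cd_eps _ (show 1 ≤ i + 1 by omega) hi]
    split_ifs <;> first | omega | simp
  rw [c, s, mul_add, mul_smul_comm, mul_smul_comm, ← X_mul, ← X_mul]
  congr 2
  ring

lemma rel5 {j : ℕ} (h1 : 1 ≤ r) (hj : j ≠ r) :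
    Top F r k kr ur r * Mx (epsV r j) = Mx (epsV r j) * Top F r k kr ur r := by
  refine op_ext fun y => ?_
  simp only [Module.End.mul_apply, Mx_apply, X_mul]
  rw [Top_r k kr ur, Top_r k kr ur]
  have c : cd r (epsV r j + y) r = cd r y r := by
    rw [cd_add, cd_eps _ h1 le_rfl, if_neg hj.symm]
    simp
  have s : sW r r (epsV r j + y) = epsV r j + sW r r y := by
    refine cd_ext fun l h h' => ?_
    simp only [cd_add, cd_sr _ h h', cd_eps _ h h']
    split_ifs <;> first | omega | simp
  rw [c, s, mul_add, mul_add, mul_smul_comm, mul_smul_comm, mul_smul_comm, ← X_mul, ← X_mul]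
  congr 2
  · congr 1
    ring
  · ring

/-! ### Quadratic relations: algebra -/

lemma alg_Q {K R : Type*} [Field K] [Ring R] [Algebra K R] (a : K) {T x x' : R}
    (h1 : T * x = x' * (T - a • 1)) (h2 : T * x' = x * T + a • x') :
    (T * T - a • T - 1) * x = x * (T * T - a • T - 1) ∧
      (T * T - a • T - 1) * x' = x' * (T * T - a • T - 1) := by
  constructor
  · have e : T * T * x = x * T * T - a • (x * T) + a • (T * x) := by
      rw [mul_assoc, h1, ← mul_assoc, h2]
      simp only [mul_sub, add_mul, smul_mul_assoc, mul_smul_comm, mul_one, mul_assoc]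
      module
    rw [sub_mul, sub_mul, e]
    simp only [mul_sub, smul_mul_assoc, mul_smul_comm, mul_one, one_mul, mul_assoc]
    abel
  · have e : T * T * x' = x' * T * T - a • (x' * T) + a • (T * x') := by
      rw [mul_assoc, h2, mul_add, ← mul_assoc, h1, mul_smul_comm, h2]
      simp only [mul_sub, sub_mul, smul_mul_assoc, mul_smul_comm, mul_one, mul_assoc]
    rw [sub_mul, sub_mul, e]
    simp only [mul_sub, smul_mul_assoc, mul_smul_comm, mul_one, one_mul, mul_assoc]
    abel

lemma alg_QB {K R : Type*} [Field K] [Ring R] [Algebra K R] (b c : K) {T x x' : R}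
    (h1 : T * x = x' * (T - b • 1) - c • 1) (h2 : T * x' = x * T + b • x' + c • 1) :
    (T * T - b • T - 1) * x = x * (T * T - b • T - 1) := by
  have e : T * T * x = x * T * T - b • (x * T) + b • (T * x) := by
    rw [mul_assoc, h1, mul_sub, ← mul_assoc, h2]
    simp only [mul_sub, add_mul, smul_mul_assoc, mul_smul_comm, mul_one, one_mul, mul_assoc,
      smul_sub]
    module
  rw [sub_mul, sub_mul, e]
  simp only [mul_sub, smul_mul_assoc, mul_smul_comm, mul_one, one_mul, mul_assoc]
  abel

/-! ### Operators preserving a kernel -/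

/-- The algebra of operators preserving the kernel of `S`. -/
def Cs (S : Module.End F (QA F r)) : Subalgebra F (Module.End F (QA F r)) where
  carrier := {P | ∀ f, S f = 0 → S (P f) = 0}
  mul_mem' := fun {P Q} hP hQ f hf => hP _ (hQ f hf)
  add_mem' := fun {P Q} hP hQ f hf => by
    rw [LinearMap.add_apply, map_add, hP f hf, hQ f hf, add_zero]
  algebraMap_mem' := fun c f hf => by
    rw [Module.algebraMap_end_apply, map_smul, hf, smul_zero]

lemma Cs_of {S P Q : Module.End F (QA F r)} (h : S * P = Q * S) : P ∈ Cs S := fun f hf => by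
  have := congrArg (fun G : Module.End F (QA F r) => G f) h
  simp only [Module.End.mul_apply] at this
  rw [this, hf, map_zero]

lemma intertw_neg {S : Module.End F (QA F r)} {e e' : E r} (h : S * Mx e = Mx e' * S) :
    S * Mx (-e) = Mx (-e') * S := by
  calc S * Mx (-e) = (Mx (-e') * Mx e') * S * Mx (-e) := by rw [Mx_neg_mul, one_mul]
    _ = Mx (-e') * (S * Mx e) * Mx (-e) := by rw [h]; noncomm_ring
    _ = Mx (-e') * S * (Mx e * Mx (-e)) := by noncomm_ring
    _ = _ := by rw [Mx_mul_neg, mul_one]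

lemma Cs_pair {S : Module.End F (QA F r)} {e e' : E r} (h : S * Mx e = Mx e' * S) :
    Mx e ∈ Cs S ∧ Mx (-e) ∈ Cs S := ⟨Cs_of h, Cs_of (intertw_neg h)⟩

/-- The closed box `[-1/2, 1/2]^r`. -/
def Box (y : E r) : Prop := ∀ j, 1 ≤ j → j ≤ r → -(1 / 2) ≤ cd r y j ∧ cd r y j ≤ 1 / 2

lemma zero_of_box {S : Module.End F (QA F r)}
    (hS : ∀ j, 1 ≤ j → j ≤ r → Mx (epsV r j) ∈ Cs S ∧ Mx (-epsV r j) ∈ Cs S)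
    (hb : ∀ y, Box y → S (X F r y) = 0) : S = 0 := by
  let G : AddSubgroup (E r) :=
    { carrier := {v | Mx v ∈ Cs S ∧ Mx (-v) ∈ Cs S}
      zero_mem' := by
        simp only [Set.mem_setOf_eq, neg_zero, Mx_zero, one_mem, and_self]
      add_mem' := fun {v w} hv hw => by
        refine ⟨?_, ?_⟩
        · rw [Mx_add]; exact mul_mem hv.1 hw.1
        · rw [neg_add, Mx_add]; exact mul_mem hv.2 hw.2
      neg_mem' := fun {v} hv => ⟨hv.2, by rw [neg_neg]; exact hv.1⟩ }
  have hG : ∀ n : Fin r → ℤ, (∑ m : Fin r, n m • epsV r ((m : ℕ) + 1)) ∈ G := fun n =>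
    AddSubgroup.sum_mem G fun m _ => AddSubgroup.zsmul_mem G
      (hS _ (by omega) (by have := m.2; omega)) _
  refine op_ext fun y => ?_
  set n : Fin r → ℤ := fun m => ⌊y m + 1 / 2⌋ with hn
  set v := ∑ m : Fin r, n m • epsV r ((m : ℕ) + 1) with hv
  have hvm : ∀ m, v m = n m := fun m => by
    rw [hv, Finset.sum_apply, Finset.sum_eq_single m]
    · simp [epsV]
    · intro b _ hbm
      have : ¬ ((m : ℕ) = b) := fun h => hbm (Fin.ext h.symm)
      simp [epsV, this]
    · simp
  have hy : Box (y - v) := fun j h1 h2 => by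
    rw [cd_fun _ h1 h2, Pi.sub_apply, hvm]
    have a1 := Int.floor_le (y ⟨j - 1, by omega⟩ + 1 / 2)
    have a2 := Int.lt_floor_add_one (y ⟨j - 1, by omega⟩ + 1 / 2)
    simp only [hn]
    constructor <;> linarith
  have := (hG n).1 _ (hb _ hy)
  rwa [Mx_apply, X_mul, add_sub_cancel] at this

/-! ### Dominant steps -/

def kapA (k : F) (α : ℝ) : F := if α = 0 then k else if α = 1 then k⁻¹ else 1
def kapB (kr ur : F) (c : ℝ) : F := if c = 0 then kr else if c = 1 / 2 then ur⁻¹ else 1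

lemma kapA_ne {k : F} (hk : k ≠ 0) (α : ℝ) : kapA k α ≠ 0 := by
  unfold kapA; split_ifs <;> simp [hk]
lemma kapB_ne {kr ur : F} (hk : kr ≠ 0) (hu : ur ≠ 0) (α : ℝ) : kapB kr ur α ≠ 0 := by
  unfold kapB; split_ifs <;> simp [hk, hu]

lemma chiZ_zero {z : ℝ} (n : ℤ) (h1 : n < z) (h2 : z < n + 1) : chiZ z = 0 := by
  unfold chiZ
  rw [if_neg]
  rintro ⟨m, rfl⟩
  have a : n < m := by exact_mod_cast h1
  have b : m < n + 1 := by exact_mod_cast h2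
  omega

lemma chiZ_one (n : ℤ) : chiZ (n : ℝ) = 1 := if_pos ⟨n, rfl⟩

lemma chiE_eq (c : ℝ) : chiE (2 * c) = chiZ c := by
  unfold chiE chiZ
  congr 1
  apply propext
  constructor <;> rintro ⟨m, h⟩ <;> exact ⟨m, by linarith⟩

lemma chiO_eq (c : ℝ) : chiO (2 * c) = chiZ (c - 1 / 2) := by
  unfold chiO chiZ
  congr 1
  apply propext
  constructor <;> rintro ⟨m, h⟩ <;> exact ⟨m, by linarith⟩

lemma si_si {i : ℕ} (h1 : 1 ≤ i) (hi : i < r) (y : E r) : sW r i (sW r i y) = y := by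
  refine cd_ext fun j h h' => ?_
  simp only [cd_si _ hi h h', cd_si _ hi h1 hi.le, cd_si _ hi (show 1 ≤ i + 1 by omega) hi]
  split_ifs <;> first | omega | (subst_vars; rfl)

lemma sr_sr (y : E r) : sW r r (sW r r y) = y := by
  refine cd_ext fun j h h' => ?_
  simp only [cd_sr _ h h']
  split_ifs <;> simp

lemma box_si {i : ℕ} (h1 : 1 ≤ i) (hi : i < r) {y : E r} (hy : Box y) : Box (sW r i y) := by
  intro j h h'
  rw [cd_si _ hi h h']
  split_ifs
  · exact hy _ (by omega) hi
  · exact hy _ h1 hi.le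
  · exact hy _ h h'

lemma box_sr {y : E r} (hy : Box y) : Box (sW r r y) := by
  intro j h h'
  rw [cd_sr _ h h']
  have := hy _ h h'
  split_ifs
  · constructor <;> linarith
  · exact this

lemma dom_i {i : ℕ} (h1 : 1 ≤ i) (hi : i < r) {y : E r} (hy : Box y)
    (h : cd r y (i + 1) ≤ cd r y i) :
    Top F r k kr ur i (X F r y) =
      kapA k (cd r y i - cd r y (i + 1)) • X F r (sW r i y) := by
  rw [Top_i k kr ur hi]
  have b1 := hy _ h1 hi.le
  have b2 := hy _ (show 1 ≤ i + 1 by omega) hi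
  have hs : cd r y i - cd r y (i + 1) = 1 →
      sW r i y = -(epsV r i - epsV r (i + 1)) + y := fun h1' => by
    refine cd_ext fun j h h' => ?_
    simp only [cd_add, cd_neg, cd_sub, cd_si _ hi h h', cd_eps _ h h']
    split_ifs <;> first | omega | (subst_vars; linarith)
  generalize hα : cd r y i - cd r y (i + 1) = α at *
  have c1 : 0 ≤ α := by linarith
  have c2 : α ≤ 1 := by linarith
  unfold kapA
  by_cases e0 : α = 0
  · have := chiZ_one 0
    rw [Int.cast_zero] at this
    rw [if_pos e0, e0, this, Int.floor_zero, neg_zero, geom_zero]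
    simp
  rw [if_neg e0]
  by_cases e1 : α = 1
  · have := chiZ_one 1
    rw [Int.cast_one] at this
    rw [if_pos e1, hs e1, e1, this, Int.floor_one, geom_neg_one, neg_mul, X_mul]
    module
  rw [if_neg e1]
  have c3 : 0 < α := lt_of_le_of_ne c1 (Ne.symm e0)
  have c4 : α < 1 := lt_of_le_of_ne c2 e1
  rw [chiZ_zero 0 (by simpa using c3) (by simpa using c4),
    Int.floor_eq_zero_iff.2 ⟨c1, c4⟩, neg_zero, geom_zero]
  simp

lemma nd_i {i : ℕ} (h1 : 1 ≤ i) (hi : i < r) {y : E r} (hy : Box y)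
    (h : cd r y i < cd r y (i + 1)) :
    Top F r k kr ur i (X F r y) =
      k ^ chiZ (cd r y i - cd r y (i + 1)) • X F r (sW r i y) + (k - k⁻¹) • X F r y := by
  rw [Top_i k kr ur hi]
  have b1 := hy _ h1 hi.le
  have b2 := hy _ (show 1 ≤ i + 1 by omega) hi
  have : ⌊cd r y i - cd r y (i + 1)⌋ = -1 := by
    rw [Int.floor_eq_iff]; push_cast; constructor <;> linarith
  rw [this, neg_neg, geom_one, one_mul]

lemma dom_r (h1 : 1 ≤ r) {y : E r} (hy : Box y) (h : 0 ≤ cd r y r) :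
    Top F r k kr ur r (X F r y) = kapB kr ur (cd r y r) • X F r (sW r r y) := by
  rw [Top_r k kr ur]
  have b1 := hy _ h1 le_rfl
  have hs : cd r y r = 1 / 2 → sW r r y = -epsV r r + y := fun h1' => by
    refine cd_ext fun j h h' => ?_
    simp only [cd_add, cd_neg, cd_sub, cd_sr _ h h', cd_eps _ h h']
    split_ifs
    · subst_vars; linarith
    · simp
  rw [chiE_eq, chiO_eq]
  generalize hα : cd r y r = α at *
  have f0 : ⌊α⌋ = 0 := Int.floor_eq_zero_iff.2 ⟨h, by linarith⟩
  rw [f0, neg_zero, geom_zero]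
  unfold kapB
  by_cases e0 : α = 0
  · have := chiZ_one 0
    rw [Int.cast_zero] at this
    have f1 : ⌊α + 1 / 2⌋ = 0 :=
      Int.floor_eq_zero_iff.2 ⟨by linarith, by linarith⟩
    rw [if_pos e0, f1, e0, this, chiZ_zero (-1) (by norm_num) (by norm_num), neg_zero, geom_zero]
    simp
  rw [if_neg e0]
  have c3 : 0 < α := lt_of_le_of_ne h (Ne.symm e0)
  have z1 : chiZ α = 0 := chiZ_zero 0 (by simpa using c3) (by push_cast; linarith)
  rw [z1]
  by_cases e1 : α = 1 / 2
  · have := chiZ_one 0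
    rw [Int.cast_zero] at this
    have f1 : ⌊α + 1 / 2⌋ = 1 := by
      rw [Int.floor_eq_iff]; push_cast; constructor <;> linarith
    rw [if_pos e1, hs e1, f1, e1, sub_self, this, geom_neg_one, mul_neg, X_mul, neg_mul, X_mul]
    have : epsV r r + -((2 : ℝ) • epsV r r) + y = -epsV r r + y := by module
    rw [this]
    simp only [zero_mul, smul_zero, add_zero, pow_zero, one_mul, pow_one]
    module
  rw [if_neg e1]
  have c4 : α < 1 / 2 := lt_of_le_of_ne b1.2 e1
  have f1 : ⌊α + 1 / 2⌋ = 0 :=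
      Int.floor_eq_zero_iff.2 ⟨by linarith, by linarith⟩
  rw [f1, chiZ_zero (-1) (by push_cast; linarith) (by push_cast; linarith), neg_zero, geom_zero]
  simp

lemma nd_r (h1 : 1 ≤ r) {y : E r} (hy : Box y) (h : cd r y r < 0) :
    Top F r k kr ur r (X F r y) = ur ^ chiZ (cd r y r - 1 / 2) • X F r (sW r r y)
      + (kr - kr⁻¹) • X F r y := by
  rw [Top_r k kr ur]
  have b1 := hy _ h1 le_rfl
  have f0 : ⌊cd r y r⌋ = -1 := by
    rw [Int.floor_eq_iff]; push_cast; constructor <;> linarith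
  have f1 : ⌊cd r y r + 1 / 2⌋ = 0 :=
      Int.floor_eq_zero_iff.2 ⟨by linarith, by linarith⟩
  rw [chiE_eq, chiO_eq, f0, f1, neg_neg, geom_one, neg_zero, geom_zero,
    chiZ_zero (-1) (by push_cast; linarith) (by push_cast; linarith)]
  simp

variable {k kr ur}

lemma refl_i {S : Module.End F (QA F r)} (hk : k ≠ 0) {i : ℕ} (h1 : 1 ≤ i) (hi : i < r)
    (hT : Top F r k kr ur i ∈ Cs S) {y : E r} (hy : Box y) (h : cd r y i ≤ cd r y (i + 1))
    (h0 : S (X F r (sW r i y)) = 0) : S (X F r y) = 0 := by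
  have a := hT _ h0
  rw [dom_i k kr ur h1 hi (box_si h1 hi hy), map_smul, si_si h1 hi] at a
  · exact (smul_eq_zero.1 a).resolve_left (kapA_ne hk _)
  · rw [cd_si _ hi h1 hi.le, cd_si _ hi (by omega) hi]
    simpa using h

lemma refl_r {S : Module.End F (QA F r)} (hk : kr ≠ 0) (hu : ur ≠ 0) (h1 : 1 ≤ r)
    (hT : Top F r k kr ur r ∈ Cs S) {y : E r} (hy : Box y) (h : cd r y r ≤ 0)
    (h0 : S (X F r (sW r r y)) = 0) : S (X F r y) = 0 := by
  have a := hT _ h0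
  rw [dom_r k kr ur h1 (box_sr hy), map_smul, sr_sr] at a
  · exact (smul_eq_zero.1 a).resolve_left (kapB_ne hk hu _)
  · rw [cd_sr _ h1 le_rfl]
    simpa using h

/-! ### Quadratic relations -/

lemma quad_i (hk : k ≠ 0) {i : ℕ} (h1 : 1 ≤ i) (hi : i < r) :
    Top F r k kr ur i * Top F r k kr ur i = (k - k⁻¹) • Top F r k kr ur i + 1 := by
  set T := Top F r k kr ur i with hT
  suffices h : T * T - (k - k⁻¹) • T - 1 = 0 by
    rw [sub_sub, sub_eq_zero] at h; exact h
  have hQ := alg_Q (k - k⁻¹) (rel1 k kr ur h1 hi) (rel2 k kr ur h1 hi)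
  rw [← hT] at hQ
  have hST : T ∈ Cs (T * T - (k - k⁻¹) • T - 1) := by
    refine Cs_of (Q := T) ?_
    simp only [mul_sub, sub_mul, smul_mul_assoc, mul_smul_comm, mul_one, one_mul, mul_assoc]
  have hdom : ∀ y, Box y → cd r y (i + 1) ≤ cd r y i →
      (T * T - (k - k⁻¹) • T - 1) (X F r y) = 0 := by
    intro y hy h
    have cs1 : cd r (sW r i y) i = cd r y (i + 1) := by
      rw [cd_si _ hi h1 hi.le]; simp
    have cs2 : cd r (sW r i y) (i + 1) = cd r y i := by
      rw [cd_si _ hi (by omega) hi]; simp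
    have e1 := dom_i k kr ur h1 hi hy h
    rw [← hT] at e1
    simp only [LinearMap.sub_apply, Module.End.mul_apply, LinearMap.smul_apply,
      Module.End.one_apply]
    rcases h.eq_or_lt with h0 | h0
    · have : sW r i y = y := by
        refine cd_ext fun j h h' => ?_
        rw [cd_si _ hi h h']
        split_ifs <;> subst_vars <;> simp [h0]
      rw [this, h0, sub_self, kapA, if_pos rfl] at e1
      rw [e1, map_smul, e1, smul_smul, smul_smul, ← sub_smul, sub_mul, inv_mul_cancel₀ hk]
      module
    · have e2 := nd_i k kr ur h1 hi (box_si h1 hi hy) (by rw [cs1, cs2]; exact h0)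
      rw [← hT, cs1, cs2, si_si h1 hi] at e2
      rw [e1, map_smul, e2]
      have b1 := hy _ h1 hi.le
      have b2 := hy _ (show 1 ≤ i + 1 by omega) hi
      unfold kapA
      rw [if_neg (by linarith)]
      by_cases h3 : cd r y i - cd r y (i + 1) = 1
      · have : chiZ (cd r y (i + 1) - cd r y i) = 1 := by
          have := chiZ_one (-1)
          rwa [show ((-1 : ℤ) : ℝ) = cd r y (i + 1) - cd r y i by push_cast; linarith] at this
        rw [if_pos h3, this, pow_one, smul_add, smul_smul, inv_mul_cancel₀ hk, one_smul,
          smul_comm k⁻¹]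
        abel
      · have h4 : cd r y i - cd r y (i + 1) < 1 := lt_of_le_of_ne (by linarith) h3
        rw [if_neg h3, chiZ_zero (-1) (by push_cast; linarith) (by push_cast; linarith)]
        simp
  refine zero_of_box (fun j hj hj' => ?_) fun y hy => ?_
  · by_cases e : j = i
    · subst e; exact Cs_pair hQ.1
    by_cases e' : j = i + 1
    · subst e'; exact Cs_pair hQ.2
    have : Commute T (Mx (epsV r j)) := rel4 k kr ur h1 hi e e'
    exact Cs_pair (((this.mul_left this).sub_left (this.smul_left _)).sub_left
      (Commute.one_left _))
  · rcases le_total (cd r y (i + 1)) (cd r y i) with h | h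
    · exact hdom y hy h
    · refine refl_i hk h1 hi hST hy h (hdom _ (box_si h1 hi hy) ?_)
      rw [cd_si _ hi h1 hi.le, cd_si _ hi (by omega) hi]
      simpa using h

lemma rel3' (h1 : 1 ≤ r) :
    Top F r k kr ur r * Mx (-epsV r r) =
      Mx (epsV r r) * Top F r k kr ur r + (kr - kr⁻¹) • Mx (-epsV r r) + (ur - ur⁻¹) • 1 := by
  have h := rel3 k kr ur h1
  set T := Top F r k kr ur r
  have h2 : Mx (epsV r r) * (T * Mx (epsV r r)) * Mx (-epsV r r) =
     Mx (epsV r r) * (Mx (-epsV r r) * (T - (kr - kr⁻¹) • 1) - (ur - ur⁻¹) • 1)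
      * Mx (-epsV r r) := by rw [h]
  rw [mul_sub, ← mul_assoc, ← mul_assoc, Mx_mul_neg, one_mul, mul_assoc, Mx_mul_neg, mul_one,
    sub_mul, sub_mul, mul_smul_comm, smul_mul_assoc, smul_mul_assoc, one_mul, mul_one,
    Mx_mul_neg] at h2
  rw [h2]; abel

lemma quad_r (hk : kr ≠ 0) (hu : ur ≠ 0) (h1 : 1 ≤ r) :
    Top F r k kr ur r * Top F r k kr ur r = (kr - kr⁻¹) • Top F r k kr ur r + 1 := by
  set T := Top F r k kr ur r with hT
  suffices h : T * T - (kr - kr⁻¹) • T - 1 = 0 by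
    rw [sub_sub, sub_eq_zero] at h; exact h
  have hQ := alg_QB (kr - kr⁻¹) (ur - ur⁻¹) (rel3 k kr ur h1) (rel3' h1)
  rw [← hT] at hQ
  have hST : T ∈ Cs (T * T - (kr - kr⁻¹) • T - 1) := by
    refine Cs_of (Q := T) ?_
    simp only [mul_sub, sub_mul, smul_mul_assoc, mul_smul_comm, mul_one, one_mul, mul_assoc]
  have hdom : ∀ y, Box y → 0 ≤ cd r y r →
      (T * T - (kr - kr⁻¹) • T - 1) (X F r y) = 0 := by
    intro y hy h
    have cs1 : cd r (sW r r y) r = -cd r y r := by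
      rw [cd_sr _ h1 le_rfl]; simp
    have e1 := dom_r k kr ur h1 hy h
    rw [← hT] at e1
    simp only [LinearMap.sub_apply, Module.End.mul_apply, LinearMap.smul_apply,
      Module.End.one_apply]
    rcases h.eq_or_lt with h0 | h0
    · have : sW r r y = y := by
        refine cd_ext fun j h h' => ?_
        rw [cd_sr _ h h']
        split_ifs <;> subst_vars <;> simp [← h0]
      rw [this, ← h0, kapB, if_pos rfl] at e1
      rw [e1, map_smul, e1, smul_smul, smul_smul, ← sub_smul, sub_mul, inv_mul_cancel₀ hk]
      module
    · have e2 := nd_r k kr ur h1 (box_sr hy) (by rw [cs1]; linarith)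
      rw [← hT, cs1, sr_sr] at e2
      rw [e1, map_smul, e2]
      have b1 := hy _ h1 le_rfl
      unfold kapB
      rw [if_neg (by linarith)]
      by_cases h3 : cd r y r = 1 / 2
      · have : chiZ (-cd r y r - 1 / 2) = 1 := by
          have := chiZ_one (-1)
          rwa [show ((-1 : ℤ) : ℝ) = -cd r y r - 1 / 2 by push_cast; linarith] at this
        rw [if_pos h3, this, pow_one, smul_add, smul_smul, inv_mul_cancel₀ hu, one_smul,
          smul_comm ur⁻¹]
        abel
      · have h4 : cd r y r < 1 / 2 := lt_of_le_of_ne (by linarith) h3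
        rw [if_neg h3, chiZ_zero (-1) (by push_cast; linarith) (by push_cast; linarith)]
        simp
  refine zero_of_box (fun j hj hj' => ?_) fun y hy => ?_
  · by_cases e : j = r
    · subst e; exact Cs_pair hQ
    have : Commute T (Mx (epsV r j)) := rel5 k kr ur h1 e
    exact Cs_pair (((this.mul_left this).sub_left (this.smul_left _)).sub_left
      (Commute.one_left _))
  · rcases le_total 0 (cd r y r) with h | h
    · exact hdom y hy h
    · refine refl_r hk hu h1 hST hy h (hdom _ (box_sr hy) ?_)
      rw [cd_sr _ h1 le_rfl]
      simpa using h
lemma alg_D_x {K R : Type*} [Field K] [Ring R] [Algebra K R] (a : K) {A B x x' : R}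
    (h1 : A * x = x' * (A - a • 1)) (h2 : Commute B x) (h3 : Commute B x') :
    (A * B - B * A) * x = x' * (A * B - B * A) := by
  have e1 : A * B * x = x' * (A - a • 1) * B := by
    rw [mul_assoc, h2.eq, ← mul_assoc, h1]
  have e2 : B * A * x = x' * B * (A - a • 1) := by
    rw [mul_assoc, h1, ← mul_assoc, h3.eq]
  rw [sub_mul, e1, e2]
  simp only [mul_sub, sub_mul, smul_mul_assoc, mul_smul_comm, mul_one, mul_assoc]
  abel

lemma alg_D_xr {K R : Type*} [Field K] [Ring R] [Algebra K R] (b c : K) {A B x x' : R}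
    (h1 : B * x = x' * (B - b • 1) - c • 1) (h2 : A * x = x * A) (h3 : A * x' = x' * A) :
    (A * B - B * A) * x = x' * (A * B - B * A) := by
  have e1 : A * B * x = x' * A * (B - b • 1) - c • A := by
    rw [mul_assoc, h1, mul_sub, ← mul_assoc, h3, mul_smul_comm, mul_one]
  have e2 : B * A * x = x' * (B - b • 1) * A - c • A := by
    rw [mul_assoc, h2, ← mul_assoc, h1, sub_mul, smul_mul_assoc, one_mul]
  rw [sub_mul, e1, e2]
  simp only [mul_sub, sub_mul, smul_mul_assoc, mul_smul_comm, mul_one, mul_assoc]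
  abel


/-! ### Moving along the variables -/

lemma step_rel {i : ℕ} (hk : k ≠ 0) (h1 : 1 ≤ i) (hi : i < r) :
    Top F r k kr ur i * Mx (epsV r i) * Top F r k kr ur i = Mx (epsV r (i + 1)) ∧
    (Top F r k kr ur i - (k - k⁻¹) • 1) * Mx (-epsV r i) *
      (Top F r k kr ur i - (k - k⁻¹) • 1) = Mx (-epsV r (i + 1)) := by
  have hinv := alg_inv _ _ (quad_i (kr := kr) (ur := ur) hk h1 hi)
  have h := rel1 k kr ur h1 hi
  set T := Top F r k kr ur i
  set T' := T - (k - k⁻¹) • 1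
  have e : T * Mx (epsV r i) * T = Mx (epsV r (i + 1)) := by
    rw [h, mul_assoc, hinv.2, mul_one]
  refine ⟨e, ?_⟩
  calc T' * Mx (-epsV r i) * T' =
      T' * Mx (-epsV r i) * T' * (Mx (epsV r (i + 1)) * Mx (-epsV r (i + 1))) := by
        rw [Mx_mul_neg, mul_one]
    _ = T' * Mx (-epsV r i) * (T' * T) * Mx (epsV r i) * T * Mx (-epsV r (i + 1)) := by
        rw [← e]; noncomm_ring
    _ = T' * (Mx (-epsV r i) * Mx (epsV r i)) * T * Mx (-epsV r (i + 1)) := by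
        rw [hinv.2]; noncomm_ring
    _ = _ := by rw [Mx_neg_mul, mul_one, hinv.2, one_mul]

lemma step_mem {S : Module.End F (QA F r)} {i : ℕ} (hk : k ≠ 0) (h1 : 1 ≤ i) (hi : i < r)
    (hT : Top F r k kr ur i ∈ Cs S)
    (h : Mx (epsV r i) ∈ Cs S ∧ Mx (-epsV r i) ∈ Cs S) :
    Mx (epsV r (i + 1)) ∈ Cs S ∧ Mx (-epsV r (i + 1)) ∈ Cs S := by
  obtain ⟨e1, e2⟩ := step_rel (kr := kr) (ur := ur) hk h1 hi
  have hT' : Top F r k kr ur i - (k - k⁻¹) • 1 ∈ Cs S :=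
    sub_mem hT (Subalgebra.smul_mem _ (one_mem _) _)
  rw [← e1, ← e2]
  exact ⟨mul_mem (mul_mem hT h.1) hT, mul_mem (mul_mem hT' h.2) hT'⟩

/-! ### Type A braid relation -/

lemma braidA (hk : k ≠ 0) {i : ℕ} (h1 : 1 ≤ i) (hi : i + 2 ≤ r) :
    Top F r k kr ur i * Top F r k kr ur (i + 1) * Top F r k kr ur i =
      Top F r k kr ur (i + 1) * Top F r k kr ur i * Top F r k kr ur (i + 1) := by
  have hi1 : i < r := by omega
  have hi2 : i + 1 < r := by omega
  have h2 : 1 ≤ i + 1 := by omega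
  have qA := quad_i (kr := kr) (ur := ur) hk h1 hi1
  have qB := quad_i (kr := kr) (ur := ur) hk h2 hi2
  have iA := alg_inv _ _ qA
  have iB := alg_inv _ _ qB
  have rA := rel1 k kr ur h1 hi1
  have rB := rel1 k kr ur h2 hi2
  have cB := rel4 k kr ur (j := i) h2 hi2 (by omega) (by omega)
  have cA := rel4 k kr ur (j := i + 1 + 1) h1 hi1 (by omega) (by omega)
  have oA : ∀ j, j ≠ i → j ≠ i + 1 → Commute (Top F r k kr ur i) (Mx (epsV r j)) :=
    fun j => rel4 k kr ur h1 hi1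
  have oB : ∀ j, j ≠ i + 1 → j ≠ i + 1 + 1 → Commute (Top F r k kr ur (i + 1)) (Mx (epsV r j)) :=
    fun j => rel4 k kr ur h2 hi2
  have dA := fun y (hy : Box y) => dom_i k kr ur h1 hi1 hy
  have dB := fun y (hy : Box y) => dom_i k kr ur h2 hi2 hy
  rw [← sub_eq_zero]
  have hRA := alg_A_RA _ _ _ qA qB
  have hRB := alg_A_RA _ _ _ qB qA
  have x1 := alg_A_x1 iA.1 iA.2 iB.1 iB.2 hRA hRB rA rB cB cA
  have mA := Cs_of (neg_out hRA)
  have mB : Top F r k kr ur (i + 1) ∈ Cs (Top F r k kr ur i * Top F r k kr ur (i + 1) *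
      Top F r k kr ur i - Top F r k kr ur (i + 1) * Top F r k kr ur i *
      Top F r k kr ur (i + 1)) := Cs_of (neg_out (neg_swap hRB))
  have sA := fun y (hy : Box y) => refl_i hk h1 hi1 mA hy
  have sB := fun y (hy : Box y) => refl_i hk h2 hi2 mB hy
  have p1 := Cs_pair x1
  have p2 := step_mem hk h1 hi1 mA p1
  have p3 := step_mem hk h2 hi2 mB p2
  -- coordinates
  have ca1 : ∀ y : E r, cd r (sW r i y) i = cd r y (i + 1) := fun y => by
    rw [cd_si _ hi1 h1 hi1.le]; simp
  have ca2 : ∀ y : E r, cd r (sW r i y) (i + 1) = cd r y i := fun y => by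
    rw [cd_si _ hi1 h2 hi1]; simp
  have ca3 : ∀ y : E r, cd r (sW r i y) (i + 1 + 1) = cd r y (i + 1 + 1) := fun y => by
    rw [cd_si _ hi1 (by omega) hi2, if_neg (by omega), if_neg (by omega)]
  have cb1 : ∀ y : E r, cd r (sW r (i + 1) y) i = cd r y i := fun y => by
    rw [cd_si _ hi2 h1 hi1.le, if_neg (by omega), if_neg (by omega)]
  have cb2 : ∀ y : E r, cd r (sW r (i + 1) y) (i + 1) = cd r y (i + 1 + 1) := fun y => by
    rw [cd_si _ hi2 h2 hi1]; simp
  have cb3 : ∀ y : E r, cd r (sW r (i + 1) y) (i + 1 + 1) = cd r y (i + 1) := fun y => by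
    rw [cd_si _ hi2 (by omega) hi2]; simp
  have bA : ∀ y : E r, Box y → Box (sW r i y) := fun y => box_si h1 hi1
  have bB : ∀ y : E r, Box y → Box (sW r (i + 1) y) := fun y => box_si h2 hi2
  have ss : ∀ y : E r, sW r i (sW r (i + 1) (sW r i y)) =
      sW r (i + 1) (sW r i (sW r (i + 1) y)) := fun y => by
    refine cd_ext fun j h h' => ?_
    by_cases e : j = i
    · subst e; simp only [ca1, ca2, ca3, cb1, cb2, cb3]
    by_cases e' : j = i + 1
    · subst e'; simp only [ca1, ca2, ca3, cb1, cb2, cb3]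
    by_cases e'' : j = i + 1 + 1
    · subst e''; simp only [ca1, ca2, ca3, cb1, cb2, cb3]
    simp only [cd_si _ hi1 h h', cd_si _ hi2 h h', if_neg e, if_neg e', if_neg e'']
  generalize Top F r k kr ur i = A at *
  generalize Top F r k kr ur (i + 1) = B at *
  refine zero_of_box (fun j hj hj' => ?_) fun y hy => ?_
  · by_cases e : j = i
    · subst e; exact p1
    by_cases e' : j = i + 1
    · subst e'; exact p2
    by_cases e'' : j = i + 1 + 1
    · subst e''; exact p3
    have a := oA j e e'
    have b := oB j e' e''
    exact Cs_pair (((a.mul_left b).mul_left a).sub_left ((b.mul_left a).mul_left b))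
  · have hdom : ∀ y, Box y → cd r y (i + 1) ≤ cd r y i → cd r y (i + 1 + 1) ≤ cd r y (i + 1) →
        (A * B * A - B * A * B) (X F r y) = 0 := by
      intro y hy h h'
      simp only [LinearMap.sub_apply, Module.End.mul_apply]
      rw [dA y hy h, dB y hy h']
      simp only [map_smul]
      rw [dB _ (bA _ hy) (by rw [ca2, ca3]; linarith), dA _ (bB _ hy) (by rw [cb1, cb2]; linarith)]
      simp only [map_smul]
      rw [dA _ (bB _ (bA _ hy)) (by rw [cb1, cb2, ca1, ca3]; linarith),
        dB _ (bA _ (bB _ hy)) (by rw [ca2, ca3, cb1, cb3]; linarith), ss]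
      simp only [ca1, ca2, ca3, cb1, cb2, cb3]
      module
    have h12 : ∀ y, Box y → cd r y (i + 1) ≤ cd r y i →
        (A * B * A - B * A * B) (X F r y) = 0 := by
      intro y hy h
      rcases le_total (cd r y (i + 1 + 1)) (cd r y (i + 1)) with h' | h'
      · exact hdom y hy h h'
      refine sB y hy h' ?_
      rcases le_total (cd r y (i + 1 + 1)) (cd r y i) with h'' | h''
      · exact hdom _ (bB _ hy) (by rw [cb1, cb2]; exact h'') (by rw [cb2, cb3]; exact h')
      refine sA _ (bB _ hy) (by rw [cb1, cb2]; exact h'') ?_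
      exact hdom _ (bA _ (bB _ hy)) (by rw [ca1, ca2, cb1, cb2]; exact h'')
        (by rw [ca2, ca3, cb1, cb3]; exact h)
    rcases le_total (cd r y (i + 1)) (cd r y i) with h | h
    · exact h12 y hy h
    · exact sA y hy h (h12 _ (bA _ hy) (by rw [ca1, ca2]; exact h))

/-! ### Type C braid relation -/

lemma braidC (hk : k ≠ 0) (hkr : kr ≠ 0) (hur : ur ≠ 0) {i : ℕ} (h1 : 1 ≤ i) (hir : i + 1 = r) :
    Top F r k kr ur i * Top F r k kr ur r * Top F r k kr ur i * Top F r k kr ur r =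
      Top F r k kr ur r * Top F r k kr ur i * Top F r k kr ur r * Top F r k kr ur i := by
  have hi1 : i < r := by omega
  have h2 : 1 ≤ r := by omega
  have qA := quad_i (kr := kr) (ur := ur) hk h1 hi1
  have qB := quad_r (k := k) hkr hur h2
  have iA := alg_inv _ _ qA
  have iB := alg_inv _ _ qB
  have rA := rel1 k kr ur h1 hi1
  have rB := rel3 k kr ur h2
  have cB := rel5 k kr ur (j := i) h2 (by omega)
  have cB' := intertw_neg cB
  have st := (step_rel (kr := kr) (ur := ur) hk h1 hi1).2
  have oA : ∀ j, j ≠ i → j ≠ i + 1 → Commute (Top F r k kr ur i) (Mx (epsV r j)) :=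
    fun j => rel4 k kr ur h1 hi1
  have oB : ∀ j, j ≠ r → Commute (Top F r k kr ur r) (Mx (epsV r j)) :=
    fun j => rel5 k kr ur h2
  have dA := fun y (hy : Box y) => dom_i k kr ur h1 hi1 hy
  have dB := fun y (hy : Box y) => dom_r k kr ur h2 hy
  rw [hir] at rA st
  rw [← sub_eq_zero]
  have hRA := alg_C_RA _ _ (Top F r k kr ur r) qA
  have hRB := alg_C_RA _ _ (Top F r k kr ur i) qB
  have hRB := neg_swap hRB
  have st' : Top F r k kr ur i * Mx (-epsV r r) =
      Mx (-epsV r i) * (Top F r k kr ur i - (k - k⁻¹) • 1) := by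
    rw [← st, ← mul_assoc, ← mul_assoc, iA.1, one_mul]
  have x1 := alg_C_x1 _ iA.1 iA.2 iB.1 iB.2 hRA hRB rA rB cB cB' st'
  have mA := Cs_of (neg_out hRA)
  have mB := Cs_of (neg_out hRB)
  have sA := fun y (hy : Box y) => refl_i hk h1 hi1 mA hy
  have sB := fun y (hy : Box y) => refl_r hkr hur h2 mB hy
  have p1 := Cs_pair x1
  have p2 := step_mem hk h1 hi1 mA p1
  rw [hir] at p2
  -- coordinates
  have ca1 : ∀ y : E r, cd r (sW r i y) i = cd r y r := fun y => by
    rw [cd_si _ hi1 h1 hi1.le, hir]; simp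
  have ca2 : ∀ y : E r, cd r (sW r i y) r = cd r y i := fun y => by
    rw [cd_si _ hi1 h2 le_rfl, if_neg (by omega), if_pos hir.symm]
  have cb1 : ∀ y : E r, cd r (sW r r y) i = cd r y i := fun y => by
    rw [cd_sr _ h1 hi1.le, if_neg (by omega)]
  have cb2 : ∀ y : E r, cd r (sW r r y) r = -cd r y r := fun y => by
    rw [cd_sr _ h2 le_rfl]; simp
  have bA : ∀ y : E r, Box y → Box (sW r i y) := fun y => box_si h1 hi1
  have bB : ∀ y : E r, Box y → Box (sW r r y) := fun y => box_sr
  have ss : ∀ y : E r, sW r i (sW r r (sW r i (sW r r y))) =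
      sW r r (sW r i (sW r r (sW r i y))) := fun y => by
    refine cd_ext fun j h h' => ?_
    by_cases e : j = i
    · subst e; simp only [ca1, ca2, cb1, cb2]
    by_cases e' : j = r
    · subst e'; simp only [ca1, ca2, cb1, cb2]
    have e'' : j ≠ i + 1 := by omega
    simp only [cd_si _ hi1 h h', cd_sr _ h h', if_neg e, if_neg e', if_neg e'']
  rw [hir] at dA sA
  generalize Top F r k kr ur i = A at *
  generalize Top F r k kr ur r = B at *
  refine zero_of_box (fun j hj hj' => ?_) fun y hy => ?_
  · by_cases e : j = i
    · subst e; exact p1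
    by_cases e' : j = r
    · rw [e']; exact p2
    have a := oA j e (by omega)
    have b := oB j e'
    exact Cs_pair ((((a.mul_left b).mul_left a).mul_left b).sub_left
      (((b.mul_left a).mul_left b).mul_left a))
  · have hdom : ∀ y, Box y → cd r y r ≤ cd r y i → 0 ≤ cd r y r →
        (A * B * A * B - B * A * B * A) (X F r y) = 0 := by
      intro y hy h h'
      simp only [LinearMap.sub_apply, Module.End.mul_apply]
      rw [dA y hy h, dB y hy h']
      simp only [map_smul]
      rw [dB _ (bA _ hy) (by rw [ca2]; linarith), dA _ (bB _ hy) (by rw [cb1, cb2]; linarith)]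
      simp only [map_smul]
      rw [dA _ (bB _ (bA _ hy)) (by rw [cb1, cb2, ca1, ca2]; linarith),
        dB _ (bA _ (bB _ hy)) (by rw [ca2, cb1]; linarith)]
      simp only [map_smul]
      rw [dB _ (bA _ (bB _ (bA _ hy))) (by rw [ca2, cb1, ca1]; linarith),
        dA _ (bB _ (bA _ (bB _ hy))) (by rw [cb1, cb2, ca1, ca2, cb1, cb2]; linarith), ss]
      simp only [ca1, ca2, cb1, cb2]
      rw [show cd r y i - -cd r y r = cd r y r - -cd r y i by ring,
        show -cd r y r - -cd r y i = cd r y i - cd r y r by ring]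
      module
    have h12 : ∀ y, Box y → 0 ≤ cd r y r →
        (A * B * A * B - B * A * B * A) (X F r y) = 0 := by
      intro y hy h
      rcases le_total (cd r y r) (cd r y i) with h' | h'
      · exact hdom y hy h' h
      refine sA y hy h' ?_
      rcases le_total 0 (cd r y i) with h'' | h''
      · exact hdom _ (bA _ hy) (by rw [ca1, ca2]; exact h') (by rw [ca2]; exact h'')
      refine sB _ (bA _ hy) (by rw [ca2]; exact h'') ?_
      rcases le_total (-cd r y i) (cd r y r) with h3 | h3
      · exact hdom _ (bB _ (bA _ hy)) (by rw [cb1, cb2, ca1, ca2]; exact h3)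
          (by rw [cb2, ca2]; linarith)
      refine sA _ (bB _ (bA _ hy)) (by rw [cb1, cb2, ca1, ca2]; exact h3) ?_
      exact hdom _ (bA _ (bB _ (bA _ hy))) (by rw [ca1, ca2, cb1, cb2, ca1, ca2]; exact h3)
        (by rw [ca2, cb1, ca1]; exact h)
    rcases le_total 0 (cd r y r) with h | h
    · exact h12 y hy h
    · exact sB y hy h (h12 _ (bB _ hy) (by rw [cb2]; linarith))

/-! ### Commutation -/

lemma commI (hk : k ≠ 0) {i l : ℕ} (h1 : 1 ≤ i) (hil : i + 1 < l) (hl : l < r) :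
    Top F r k kr ur i * Top F r k kr ur l = Top F r k kr ur l * Top F r k kr ur i := by
  have hi1 : i < r := by omega
  have h2 : 1 ≤ l := by omega
  have qA := quad_i (kr := kr) (ur := ur) hk h1 hi1
  have qB := quad_i (kr := kr) (ur := ur) hk h2 hl
  have rA := rel1 k kr ur h1 hi1
  have rB := rel1 k kr ur h2 hl
  have oA : ∀ j, j ≠ i → j ≠ i + 1 → Commute (Top F r k kr ur i) (Mx (epsV r j)) :=
    fun j => rel4 k kr ur h1 hi1
  have oB : ∀ j, j ≠ l → j ≠ l + 1 → Commute (Top F r k kr ur l) (Mx (epsV r j)) :=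
    fun j => rel4 k kr ur h2 hl
  have dA := fun y (hy : Box y) => dom_i k kr ur h1 hi1 hy
  have dB := fun y (hy : Box y) => dom_i k kr ur h2 hl hy
  rw [← sub_eq_zero]
  have hRA := alg_D_RA _ _ (Top F r k kr ur l) qA
  have hRB := alg_D_RA _ _ (Top F r k kr ur i) qB
  have hRB := neg_swap hRB
  have x1 := alg_D_x _ rA (oB i (by omega) (by omega)) (oB (i + 1) (by omega) (by omega))
  have x2 := alg_D_x _ rB (oA l (by omega) (by omega)) (oA (l + 1) (by omega) (by omega))
  have x2 := neg_swap_pos x2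
  have mA := Cs_of (neg_out hRA)
  have mB := Cs_of (neg_out hRB)
  have sA := fun y (hy : Box y) => refl_i hk h1 hi1 mA hy
  have sB := fun y (hy : Box y) => refl_i hk h2 hl mB hy
  have p1 := Cs_pair x1
  have p2 := step_mem hk h1 hi1 mA p1
  have p3 := Cs_pair x2
  have p4 := step_mem hk h2 hl mB p3
  -- coordinates
  have ca1 : ∀ y : E r, cd r (sW r i y) i = cd r y (i + 1) := fun y => by
    rw [cd_si _ hi1 h1 hi1.le]; simp
  have ca2 : ∀ y : E r, cd r (sW r i y) (i + 1) = cd r y i := fun y => by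
    rw [cd_si _ hi1 (by omega) hi1]; simp
  have ca3 : ∀ y : E r, cd r (sW r i y) l = cd r y l := fun y => by
    rw [cd_si _ hi1 (by omega) hl.le, if_neg (by omega), if_neg (by omega)]
  have ca4 : ∀ y : E r, cd r (sW r i y) (l + 1) = cd r y (l + 1) := fun y => by
    rw [cd_si _ hi1 (by omega) hl, if_neg (by omega), if_neg (by omega)]
  have cb1 : ∀ y : E r, cd r (sW r l y) i = cd r y i := fun y => by
    rw [cd_si _ hl h1 hi1.le, if_neg (by omega), if_neg (by omega)]
  have cb2 : ∀ y : E r, cd r (sW r l y) (i + 1) = cd r y (i + 1) := fun y => by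
    rw [cd_si _ hl (by omega) hi1, if_neg (by omega), if_neg (by omega)]
  have cb3 : ∀ y : E r, cd r (sW r l y) l = cd r y (l + 1) := fun y => by
    rw [cd_si _ hl h2 hl.le]; simp
  have cb4 : ∀ y : E r, cd r (sW r l y) (l + 1) = cd r y l := fun y => by
    rw [cd_si _ hl (by omega) hl]; simp
  have bA : ∀ y : E r, Box y → Box (sW r i y) := fun y => box_si h1 hi1
  have bB : ∀ y : E r, Box y → Box (sW r l y) := fun y => box_si h2 hl
  have ss : ∀ y : E r, sW r i (sW r l y) = sW r l (sW r i y) := fun y => by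
    refine cd_ext fun j h h' => ?_
    rw [cd_si _ hi1 h h', cd_si _ hl h h', cd_si _ hl h h', cd_si _ hi1 h h', cb1, cb2, ca3, ca4]
    split_ifs <;> first | omega | rfl
  generalize Top F r k kr ur i = A at *
  generalize Top F r k kr ur l = B at *
  refine zero_of_box (fun j hj hj' => ?_) fun y hy => ?_
  · by_cases e : j = i
    · subst e; exact p1
    by_cases e' : j = i + 1
    · subst e'; exact p2
    by_cases e'' : j = l
    · subst e''; exact p3
    by_cases e3 : j = l + 1
    · subst e3; exact p4
    have a := oA j e e'
    have b := oB j e'' e3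
    exact Cs_pair ((a.mul_left b).sub_left (b.mul_left a))
  · have hdom : ∀ y, Box y → cd r y (i + 1) ≤ cd r y i → cd r y (l + 1) ≤ cd r y l →
        (A * B - B * A) (X F r y) = 0 := by
      intro y hy h h'
      simp only [LinearMap.sub_apply, Module.End.mul_apply]
      rw [dA y hy h, dB y hy h']
      simp only [map_smul]
      rw [dB _ (bA _ hy) (by rw [ca3, ca4]; exact h'), dA _ (bB _ hy) (by rw [cb1, cb2]; exact h), ss]
      simp only [ca3, ca4, cb1, cb2]
      module
    have h12 : ∀ y, Box y → cd r y (i + 1) ≤ cd r y i →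
        (A * B - B * A) (X F r y) = 0 := by
      intro y hy h
      rcases le_total (cd r y (l + 1)) (cd r y l) with h' | h'
      · exact hdom y hy h h'
      exact sB y hy h' (hdom _ (bB _ hy) (by rw [cb1, cb2]; exact h) (by rw [cb3, cb4]; exact h'))
    rcases le_total (cd r y (i + 1)) (cd r y i) with h | h
    · exact h12 y hy h
    · exact sA y hy h (h12 _ (bA _ hy) (by rw [ca1, ca2]; exact h))

lemma commR (hk : k ≠ 0) (hkr : kr ≠ 0) (hur : ur ≠ 0) {i : ℕ} (h1 : 1 ≤ i) (hil : i + 1 < r) :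
    Top F r k kr ur i * Top F r k kr ur r = Top F r k kr ur r * Top F r k kr ur i := by
  have hi1 : i < r := by omega
  have h2 : 1 ≤ r := by omega
  have qA := quad_i (kr := kr) (ur := ur) hk h1 hi1
  have qB := quad_r (k := k) hkr hur h2
  have rA := rel1 k kr ur h1 hi1
  have rB := rel3 k kr ur h2
  have oA : ∀ j, j ≠ i → j ≠ i + 1 → Commute (Top F r k kr ur i) (Mx (epsV r j)) :=
    fun j => rel4 k kr ur h1 hi1
  have oB : ∀ j, j ≠ r → Commute (Top F r k kr ur r) (Mx (epsV r j)) :=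
    fun j => rel5 k kr ur h2
  have dA := fun y (hy : Box y) => dom_i k kr ur h1 hi1 hy
  have dB := fun y (hy : Box y) => dom_r k kr ur h2 hy
  rw [← sub_eq_zero]
  have hRA := alg_D_RA _ _ (Top F r k kr ur r) qA
  have hRB := alg_D_RA _ _ (Top F r k kr ur i) qB
  have hRB := neg_swap hRB
  have x1 := alg_D_x _ rA (oB i (by omega)) (oB (i + 1) (by omega))
  have x2 := alg_D_xr _ _ rB (oA r (by omega) (by omega))
    (intertw_neg (oA r (by omega) (by omega)))
  have mA := Cs_of (neg_out hRA)
  have mB := Cs_of (neg_out hRB)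
  have sA := fun y (hy : Box y) => refl_i hk h1 hi1 mA hy
  have sB := fun y (hy : Box y) => refl_r hkr hur h2 mB hy
  have p1 := Cs_pair x1
  have p2 := step_mem hk h1 hi1 mA p1
  have p3 := Cs_pair x2
  -- coordinates
  have ca1 : ∀ y : E r, cd r (sW r i y) i = cd r y (i + 1) := fun y => by
    rw [cd_si _ hi1 h1 hi1.le]; simp
  have ca2 : ∀ y : E r, cd r (sW r i y) (i + 1) = cd r y i := fun y => by
    rw [cd_si _ hi1 (by omega) hi1]; simp
  have ca3 : ∀ y : E r, cd r (sW r i y) r = cd r y r := fun y => by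
    rw [cd_si _ hi1 (by omega) le_rfl, if_neg (by omega), if_neg (by omega)]
  have cb1 : ∀ y : E r, cd r (sW r r y) i = cd r y i := fun y => by
    rw [cd_sr _ h1 hi1.le, if_neg (by omega)]
  have cb2 : ∀ y : E r, cd r (sW r r y) (i + 1) = cd r y (i + 1) := fun y => by
    rw [cd_sr _ (by omega) hi1, if_neg (by omega)]
  have cb3 : ∀ y : E r, cd r (sW r r y) r = -cd r y r := fun y => by
    rw [cd_sr _ h2 le_rfl]; simp
  have bA : ∀ y : E r, Box y → Box (sW r i y) := fun y => box_si h1 hi1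
  have bB : ∀ y : E r, Box y → Box (sW r r y) := fun y => box_sr
  have ss : ∀ y : E r, sW r i (sW r r y) = sW r r (sW r i y) := fun y => by
    refine cd_ext fun j h h' => ?_
    rw [cd_si _ hi1 h h', cd_sr _ h h', cd_sr _ h h', cd_si _ hi1 h h', cb1, cb2]
    split_ifs <;> first | omega | rfl
  generalize Top F r k kr ur i = A at *
  generalize Top F r k kr ur r = B at *
  refine zero_of_box (fun j hj hj' => ?_) fun y hy => ?_
  · by_cases e : j = i
    · subst e; exact p1
    by_cases e' : j = i + 1
    · subst e'; exact p2
    by_cases e'' : j = r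
    · rw [e'']; exact p3
    have a := oA j e e'
    have b := oB j e''
    exact Cs_pair ((a.mul_left b).sub_left (b.mul_left a))
  · have hdom : ∀ y, Box y → cd r y (i + 1) ≤ cd r y i → 0 ≤ cd r y r →
        (A * B - B * A) (X F r y) = 0 := by
      intro y hy h h'
      simp only [LinearMap.sub_apply, Module.End.mul_apply]
      rw [dA y hy h, dB y hy h']
      simp only [map_smul]
      rw [dB _ (bA _ hy) (by rw [ca3]; exact h'), dA _ (bB _ hy) (by rw [cb1, cb2]; exact h), ss]
      simp only [ca3, cb1, cb2]
      module
    have h12 : ∀ y, Box y → cd r y (i + 1) ≤ cd r y i →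
        (A * B - B * A) (X F r y) = 0 := by
      intro y hy h
      rcases le_total 0 (cd r y r) with h' | h'
      · exact hdom y hy h h'
      exact sB y hy h' (hdom _ (bB _ hy) (by rw [cb1, cb2]; exact h) (by rw [cb3]; linarith))
    rcases le_total (cd r y (i + 1)) (cd r y i) with h | h
    · exact h12 y hy h
    · exact sA y hy h (h12 _ (bA _ hy) (by rw [ca1, ca2]; exact h))

lemma comm_all (hk : k ≠ 0) (hkr : kr ≠ 0) (hur : ur ≠ 0) {i l : ℕ} (h1 : 1 ≤ i)
    (hil : i + 1 < l) (hl : l ≤ r) :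
    Top F r k kr ur i * Top F r k kr ur l = Top F r k kr ur l * Top F r k kr ur i := by
  rcases hl.eq_or_lt with h | h
  · subst h; exact commR hk hkr hur h1 hil
  · exact commI hk h1 hil h

lemma quad_fac {a : F} (ha : a ≠ 0) {T : Module.End F (QA F r)}
    (h : T * T = (a - a⁻¹) • T + 1) : (T - a • 1) * (T + a⁻¹ • 1) = 0 := by
  simp only [sub_mul, mul_add, smul_mul_assoc, mul_smul_comm, mul_one, one_mul, h, smul_add,
    smul_smul, mul_inv_cancel₀ ha]
  match_scalars <;> field_simp <;> ring

end Ops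

/-- The truncated Demazure–Lusztig operators `T_1, …, T_r` on `F[ℝ^r]`
satisfy the type `C_r` braid relations and the quadratic Hecke relations. -/
theorem statement0 (F : Type*) [Field F] [CharZero F] (r : ℕ) (hr : 2 ≤ r)
    (k kr ur : Fˣ) :
    letI T : ℕ → Module.End F (QA F r) := Top F r (k : F) (kr : F) (ur : F)
    (∀ i : ℕ, 1 ≤ i → i + 2 ≤ r →
      T i * T (i + 1) * T i = T (i + 1) * T i * T (i + 1)) ∧
    (T (r - 1) * T r * T (r - 1) * T r = T r * T (r - 1) * T r * T (r - 1)) ∧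
    (∀ i i' : ℕ, 1 ≤ i → i ≤ r → 1 ≤ i' → i' ≤ r → (i + 1 < i' ∨ i' + 1 < i) →
      T i * T i' = T i' * T i) ∧
    (∀ i : ℕ, 1 ≤ i → i < r →
      (T i - (k : F) • 1) * (T i + ((k : F))⁻¹ • 1) = 0) ∧
    ((T r - (kr : F) • 1) * (T r + ((kr : F))⁻¹ • 1) = 0) := by
  have hk := k.ne_zero
  have hkr := kr.ne_zero
  have hur := ur.ne_zero
  refine ⟨fun i h1 h2 => braidA hk h1 h2, ?_, ?_, ?_, ?_⟩
  · exact braidC hk hkr hur (by omega) (by omega)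
  · rintro i l h1 h2 h3 h4 (h | h)
    · exact comm_all hk hkr hur h1 h h4
    · exact (comm_all hk hkr hur h3 h h2).symm
  · exact fun i h1 h2 => quad_fac hk (quad_i hk h1 h2)
  · exact quad_fac hkr (quad_r hkr hur (by omega))

end QP

end
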